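/- arXiv:2403.16413 — 2 statements merged into one kernel-verified Lean document; each statement's English description precedes it below -/
import Mathlib

section
/- Let α ∈ (0,1), set h̄⁺ := −λ·log α (so that α = e^{−h̄⁺/λ}), and let ε ∈ (0,1). Then the one-sided NLR test φ_n(·|h̄⁺,ε) is asymptotically uniformly most powerful at level α against positive alternatives: (i) limsup_{n→∞} ∫ φ_n(y|h̄⁺,ε) dP^n_{θ0}(y) ≤ α, and (ii) for every sequence of measurable functions ψ_n : ℝ^n → [0,1] satisfying limsup_{n→∞} ∫ ψ_n dP^n_{θ0} ≤ α and every h > 0, liminf_{n→∞} ∫ φ_n(y|h̄⁺,ε) dP^n_{θ0+h/n}(y) ≥ limsup_{n→∞} ∫ ψ_n dP^n_{θ0+h/n}. -/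
open MeasureTheory Filter Real Topology

noncomputable section

attribute [local instance] Classical.propDecidable

/-- The benchmark nonregular model of Shimizu–Otsu, satisfying Assumption 1.
`f y θ` denotes the density kernel `f(y|θ)` and the data density is
`y ↦ f(y|θ) · 𝟙{y ≥ g θ}`. -/
structure BenchmarkModel where
  θ0 : ℝ
  /-- density kernel, `f y θ = f(y|θ)` -/
  f : ℝ → ℝ → ℝ
  /-- boundary function -/
  g : ℝ → ℝ
  /-- open neighborhood of `θ0` -/
  N : Set ℝ
  /-- uniform bound on `f` over `N` -/
  C : ℝ
  N_open : IsOpen N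
  θ0_mem : θ0 ∈ N
  /-- (a) `y ↦ f(y|θ)·𝟙{y ≥ g θ}` is a probability density for every `θ`. -/
  f_nonneg : ∀ θ y, g θ ≤ y → 0 ≤ f y θ
  f_integrable : ∀ θ, IntegrableOn (fun y => f y θ) (Set.Ici (g θ))
  f_density : ∀ θ, ∫ y in Set.Ici (g θ), f y θ = 1
  /-- (b) `θ ↦ f(y|θ)` is twice continuously differentiable for every `y`. -/
  f_smooth : ∀ y, ContDiff ℝ 2 fun θ => f y θ
  /-- (c) continuity in `y` for `θ ∈ N`, and uniform positive bounds on `N` -/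
  f_cont : ∀ θ ∈ N, Continuous fun y => f y θ
  fθ_cont : ∀ θ ∈ N, Continuous fun y => deriv (fun t => f y t) θ
  f_pos : ∀ θ ∈ N, ∀ y, 0 < f y θ
  f_lt : ∀ θ ∈ N, ∀ y, f y θ < C
  /-- (d) integrability of the suprema over `N` -/
  int1 : ∫⁻ y : ℝ, ⨆ θ ∈ N,
      ENNReal.ofReal (|deriv (fun t => f y t) θ| * if g θ ≤ y then 1 else 0) < ⊤
  int2 : ∫⁻ y : ℝ, ⨆ θ ∈ N, ⨆ θ' ∈ N, ENNReal.ofReal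
      ((deriv (fun t => f y t) θ') ^ 2 / (f y θ') ^ 2 *
        (if g θ ≤ y then 1 else 0) * f y θ) < ⊤
  int3 : ∫⁻ y : ℝ, ⨆ θ ∈ N, ⨆ θ' ∈ N, ENNReal.ofReal
      (|deriv (deriv fun t => f y t) θ'| / f y θ' *
        (if g θ ≤ y then 1 else 0) * f y θ) < ⊤
  /-- (e) conditions on `g` -/
  g_smooth : ContDiff ℝ 1 g
  g_deriv_pos : 0 < deriv g θ0
  g_deriv_bdd : ∃ B, ∀ θ ∈ N, |deriv g θ| ≤ B

namespace BenchmarkModel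

variable (M : BenchmarkModel)

/-- `λ = (f(g(θ0)|θ0)·g'(θ0))⁻¹`. -/
def lam : ℝ := (M.f (M.g M.θ0) M.θ0 * deriv M.g M.θ0)⁻¹

/-- The joint measure `P_θ^n` of an iid sample of size `n` on `ℝ^n`. -/
def P (n : ℕ) (θ : ℝ) : Measure (Fin n → ℝ) :=
  (volume : Measure (Fin n → ℝ)).withDensity fun y =>
    ENNReal.ofReal (∏ i, M.f (y i) θ * if M.g θ ≤ y i then 1 else 0)

/-- The likelihood-ratio statistic `Z_n(h, h̄)`. -/
def Z (n : ℕ) (h hb : ℝ) : (Fin n → ℝ) → ℝ := fun y =>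
  if ∀ i, M.g (M.θ0 + h / n) ≤ y i then
    (if ∀ i, M.g (M.θ0 + hb / n) ≤ y i then 1 else 0) *
      ∏ i, M.f (y i) (M.θ0 + hb / n) / M.f (y i) (M.θ0 + h / n)
  else 0

end BenchmarkModel

namespace BenchmarkModel

variable (M : BenchmarkModel)

/-- The one-sided NLR test `φ_n(·|h̄,ε)` against the positive alternative,
at significance level `α` (rejection clause taking priority). -/
def phiPlus (n : ℕ) (hb ε α : ℝ) : (Fin n → ℝ) → ℝ :=
  if α ≤ exp (-hb / M.lam) then fun y =>
    if exp (hb / M.lam) * (1 + ε) < M.Z n 0 hb y ∨ ∃ i, y i < M.g M.θ0 then 1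
    else if M.Z n 0 hb y ∈ Set.Icc (exp (hb / M.lam) * (1 - ε)) (exp (hb / M.lam) * (1 + ε)) then
      α * exp (hb / M.lam)
    else 0
  else fun y =>
    if exp (hb / M.lam) * ε < M.Z n 0 hb y ∨ ∃ i, y i < M.g M.θ0 then 1
    else if M.Z n 0 hb y ∈ Set.Icc (-(exp (hb / M.lam) * ε)) (exp (hb / M.lam) * ε) then
      (α - exp (-hb / M.lam)) / (1 - exp (-hb / M.lam))
    else 0

end BenchmarkModel

namespace BenchmarkModel

variable (M : BenchmarkModel)

/-- The density of a single observation. -/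
def density (θ y : ℝ) : ℝ := M.f y θ * if M.g θ ≤ y then 1 else 0

/-- The law of a single observation. -/
def law (θ : ℝ) : Measure ℝ := volume.withDensity fun y => ENNReal.ofReal (M.density θ y)

lemma density_eq_indicator (θ : ℝ) :
    M.density θ = (Set.Ici (M.g θ)).indicator fun y => M.f y θ := by
  ext y
  by_cases h : M.g θ ≤ y <;> simp [density, h]

lemma density_nonneg (θ y : ℝ) : 0 ≤ M.density θ y := by
  rw [density_eq_indicator]
  exact Set.indicator_nonneg (fun y hy => M.f_nonneg θ y hy) y

lemma integrable_density (θ : ℝ) : Integrable (M.density θ) := by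
  rw [density_eq_indicator]
  exact (M.f_integrable θ).integrable_indicator measurableSet_Ici

lemma integral_density (θ : ℝ) : ∫ y, M.density θ y = 1 := by
  rw [density_eq_indicator, integral_indicator measurableSet_Ici, M.f_density]

lemma measurable_density {θ : ℝ} (hθ : θ ∈ M.N) : Measurable (M.density θ) := by
  rw [density_eq_indicator]
  exact (M.f_cont θ hθ).measurable.indicator measurableSet_Ici

lemma law_apply (θ : ℝ) {s : Set ℝ} (hs : MeasurableSet s) :
    M.law θ s = ENNReal.ofReal (∫ y in s, M.density θ y) := by
  rw [law, withDensity_apply _ hs, ← ofReal_integral_eq_lintegral_ofReal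
    (M.integrable_density θ).integrableOn (ae_of_all _ (M.density_nonneg θ))]

instance isProbabilityMeasure_law (θ : ℝ) : IsProbabilityMeasure (M.law θ) :=
  ⟨by rw [M.law_apply θ MeasurableSet.univ, setIntegral_univ, M.integral_density]; simp⟩

lemma P_eq_pi (n : ℕ) (θ : ℝ) : M.P n θ = Measure.pi fun _ => M.law θ := by
  symm
  refine Measure.pi_eq fun s hs => ?_
  have hint : Integrable (fun y : Fin n → ℝ => ∏ i, M.density θ (y i))
      (Measure.pi fun i => volume.restrict (s i)) :=
    Integrable.fintype_prod (f := fun _ => M.density θ) fun i =>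
      (M.integrable_density θ).integrableOn
  change (volume.withDensity fun y : Fin n → ℝ =>
    ENNReal.ofReal (∏ i, M.density θ (y i))) _ = _
  rw [withDensity_apply _ (MeasurableSet.univ_pi hs), volume_pi, Measure.restrict_pi_pi,
    ← ofReal_integral_eq_lintegral_ofReal hint
      (ae_of_all _ fun y => Finset.prod_nonneg fun i _ => M.density_nonneg θ _),
    integral_fintype_prod_eq_prod (fun _ => M.density θ),
    ENNReal.ofReal_prod_of_nonneg
      fun i _ => integral_nonneg fun y => M.density_nonneg θ y]
  exact Finset.prod_congr rfl fun i _ => (M.law_apply θ (hs i)).symm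

instance isProbabilityMeasure_P (n : ℕ) (θ : ℝ) : IsProbabilityMeasure (M.P n θ) := by
  rw [P_eq_pi]; infer_instance

lemma exists_ball_subset_monotoneOn :
    ∃ ρ > 0, Metric.ball M.θ0 ρ ⊆ M.N ∧ MonotoneOn M.g (Metric.ball M.θ0 ρ) := by
  have hc : Continuous (deriv M.g) := M.g_smooth.continuous_deriv le_rfl
  have h1 : ∀ᶠ θ in 𝓝 M.θ0, θ ∈ M.N ∧ 0 < deriv M.g θ :=
    (M.N_open.eventually_mem M.θ0_mem).and (hc.continuousAt.eventually_const_lt M.g_deriv_pos)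
  obtain ⟨ρ, hρ, h⟩ := Metric.eventually_nhds_iff_ball.1 h1
  refine ⟨ρ, hρ, fun θ hθ => (h θ hθ).1, ?_⟩
  refine monotoneOn_of_deriv_nonneg (convex_ball _ _) M.g_smooth.continuous.continuousOn
    (M.g_smooth.differentiable one_ne_zero).differentiableOn fun θ hθ => ?_
  exact (h θ (interior_subset hθ)).2.le

lemma lam_pos : 0 < M.lam :=
  inv_pos.2 (mul_pos (M.f_pos _ M.θ0_mem _) M.g_deriv_pos)

end BenchmarkModel

open scoped ENNReal in
/-- Dominated convergence with a dominating function that need not be measurable. -/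
lemma MeasureTheory.tendsto_integral_of_lintegral_bound {Ω : Type*} [MeasurableSpace Ω]
    {μ : Measure Ω} {F : ℕ → Ω → ℝ} {f : Ω → ℝ} {B : Ω → ℝ≥0∞}
    (hF : ∀ n, AEStronglyMeasurable (F n) μ) (hFB : ∀ n y, ‖F n y‖ₑ ≤ B y)
    (hB : ∫⁻ y, B y ∂μ ≠ ⊤) (hlim : ∀ᵐ y ∂μ, Tendsto (fun n => F n y) atTop (𝓝 (f y))) :
    Tendsto (fun n => ∫ y, F n y ∂μ) atTop (𝓝 (∫ y, f y ∂μ)) := by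
  have hm : AEMeasurable (fun y => ⨆ n, ‖F n y‖ₑ) μ := AEMeasurable.iSup fun n => (hF n).enorm
  have hfin : ∫⁻ y, ⨆ n, ‖F n y‖ₑ ∂μ ≠ ⊤ :=
    ne_top_of_le_ne_top hB (lintegral_mono fun y => iSup_le fun n => hFB n y)
  refine tendsto_integral_of_dominated_convergence (fun y => (⨆ n, ‖F n y‖ₑ).toReal) hF
    (integrable_toReal_of_lintegral_ne_top hm hfin) (fun n => ?_) hlim
  filter_upwards [ae_lt_top' hm hfin] with y hy
  rw [← toReal_enorm]
  exact ENNReal.toReal_mono hy.ne (le_iSup (fun n => ‖F n y‖ₑ) n)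

namespace BenchmarkModel

variable (M : BenchmarkModel)

/-- The score at `θ0`. -/
def score (y : ℝ) : ℝ := deriv (fun t => M.f y t) M.θ0 / M.f y M.θ0

lemma continuous_score : Continuous M.score :=
  (M.fθ_cont _ M.θ0_mem).div (M.f_cont _ M.θ0_mem) fun y => (M.f_pos _ M.θ0_mem y).ne'

lemma integral_Ici {c : ℝ} (hc : M.g M.θ0 ≤ c) :
    ∫ y in Set.Ici c, M.f y M.θ0 = 1 - ∫ y in (M.g M.θ0)..c, M.f y M.θ0 := by
  have h1 := intervalIntegral.integral_interval_add_Ioi (b := c)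
    ((M.f_integrable M.θ0).mono_set Set.Ioi_subset_Ici_self)
    (((M.f_integrable M.θ0).mono_set (Set.Ici_subset_Ici.2 hc)).mono_set Set.Ioi_subset_Ici_self)
  rw [← integral_Ici_eq_integral_Ioi, ← integral_Ici_eq_integral_Ioi, M.f_density] at h1
  linarith

lemma hasDerivAt_boundary_integral :
    HasDerivAt (fun θ => ∫ y in (M.g M.θ0)..(M.g θ), M.f y M.θ0) M.lam⁻¹ M.θ0 := by
  have hc := M.f_cont _ M.θ0_mem
  have h1 : HasDerivAt (fun c => ∫ y in (M.g M.θ0)..c, M.f y M.θ0) (M.f (M.g M.θ0) M.θ0)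
      (M.g M.θ0) :=
    intervalIntegral.integral_hasDerivAt_right (hc.intervalIntegrable _ _)
      hc.aestronglyMeasurable.stronglyMeasurableAtFilter hc.continuousAt
  have h2 : HasDerivAt M.g (deriv M.g M.θ0) M.θ0 :=
    (M.g_smooth.differentiable one_ne_zero M.θ0).hasDerivAt
  rw [lam, inv_inv]
  exact h1.comp M.θ0 h2

lemma integral_deriv_eq :
    ∫ y in Set.Ici (M.g M.θ0), deriv (fun t => M.f y t) M.θ0 = M.lam⁻¹ := by
  obtain ⟨ρ, hρ, hN, hg⟩ := M.exists_ball_subset_monotoneOn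
  have hmem : ∀ t, 0 ≤ t → t < ρ → M.θ0 + t ∈ Metric.ball M.θ0 ρ := fun t h0 h1 => by
    simpa [abs_of_nonneg h0] using h1
  have h0 : M.θ0 ∈ Metric.ball M.θ0 ρ := Metric.mem_ball_self hρ
  set t : ℕ → ℝ := fun n => ρ / (n + 2) with ht
  have htpos : ∀ n, 0 < t n := fun n => by positivity
  have htlt : ∀ n, t n < ρ := fun n => by
    refine div_lt_self hρ ?_
    have : (0 : ℝ) ≤ n := n.cast_nonneg
    linarith
  have htlim : Tendsto t atTop (𝓝 0) :=
    tendsto_const_nhds.div_atTop (tendsto_atTop_add_const_right _ _ tendsto_natCast_atTop_atTop)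
  have htlim' : Tendsto (fun n => M.θ0 + t n) atTop (𝓝[≠] M.θ0) := by
    refine tendsto_nhdsWithin_iff.2 ⟨by simpa using htlim.const_add M.θ0, ?_⟩
    exact Eventually.of_forall fun n => by simpa using (htpos n).ne'
  have hgn : ∀ n, M.g M.θ0 ≤ M.g (M.θ0 + t n) := fun n =>
    hg h0 (hmem _ (htpos n).le (htlt n)) (by linarith [htpos n])
  set F : ℕ → ℝ → ℝ := fun n => (Set.Ici (M.g (M.θ0 + t n))).indicator
    fun y => (M.f y (M.θ0 + t n) - M.f y M.θ0) / t n with hF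
  have hFint : ∀ n, ∫ y, F n y
      = (∫ y in (M.g M.θ0)..(M.g (M.θ0 + t n)), M.f y M.θ0) / t n := fun n => by
    rw [hF, integral_indicator measurableSet_Ici, integral_div, integral_sub (M.f_integrable _)
      ((M.f_integrable _).mono_set (Set.Ici_subset_Ici.2 (hgn n))), M.f_density,
      M.integral_Ici (hgn n)]
    ring
  have hlim1 : Tendsto (fun n => ∫ y, F n y) atTop (𝓝 M.lam⁻¹) := by
    have := M.hasDerivAt_boundary_integral.tendsto_slope.comp htlim'
    refine this.congr fun n => ?_
    rw [hFint]
    simp [slope_def_field]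
  have hlim2 : Tendsto (fun n => ∫ y, F n y) atTop
      (𝓝 (∫ y, (Set.Ici (M.g M.θ0)).indicator (fun y => deriv (fun t => M.f y t) M.θ0) y)) := by
    refine tendsto_integral_of_lintegral_bound (fun n => ?_) (fun n y => ?_) M.int1.ne ?_
    · exact Measurable.aestronglyMeasurable <| Measurable.indicator
        (((M.f_cont _ (hN (hmem _ (htpos n).le (htlt n)))).sub
          (M.f_cont _ M.θ0_mem)).div_const _).measurable measurableSet_Ici
    · by_cases hy : M.g (M.θ0 + t n) ≤ y
      · have hdiff : Differentiable ℝ fun θ => M.f y θ := (M.f_smooth y).differentiable two_ne_zero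
        obtain ⟨c, hc, hc'⟩ := exists_deriv_eq_slope (fun θ => M.f y θ)
          (lt_add_of_pos_right M.θ0 (htpos n)) hdiff.continuous.continuousOn
          hdiff.differentiableOn
        have hcb : c ∈ Metric.ball M.θ0 ρ := by
          have := hmem (c - M.θ0) (by linarith [hc.1]) (by linarith [hc.2, htlt n])
          simpa using this
        have hcy : M.g c ≤ y := (hg hcb (hmem _ (htpos n).le (htlt n)) hc.2.le).trans hy
        refine le_trans (le_of_eq ?_) (le_iSup₂ (f := fun θ (_ : θ ∈ M.N) => ENNReal.ofReal
          (|deriv (fun t => M.f y t) θ| * if M.g θ ≤ y then 1 else 0)) c (hN hcb))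
        rw [add_sub_cancel_left] at hc'
        simp only [F, Set.indicator_of_mem (Set.mem_Ici.2 hy), if_pos hcy, mul_one]
        rw [hc', Real.enorm_eq_ofReal_abs]
      · simp [F, hy]
    · filter_upwards [Measure.ae_ne volume (M.g M.θ0)] with y hy
      rcases lt_or_gt_of_ne hy with hy | hy
      · have : ∀ n, F n y = 0 := fun n =>
          Set.indicator_of_notMem (fun h => absurd (hy.trans_le (hgn n)) (not_lt.2 h)) _
        simp [this, hy]
      · have hlt : ∀ᶠ n in atTop, M.g (M.θ0 + t n) < y := by
          have hgc : Tendsto (fun n => M.g (M.θ0 + t n)) atTop (𝓝 (M.g M.θ0)) :=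
            (M.g_smooth.continuous.tendsto M.θ0).comp (htlim'.mono_right nhdsWithin_le_nhds)
          exact hgc.eventually_lt_const hy
        have hd : HasDerivAt (fun θ => M.f y θ) (deriv (fun t => M.f y t) M.θ0) M.θ0 :=
          ((M.f_smooth y).differentiable two_ne_zero _).hasDerivAt
        rw [Set.indicator_of_mem (Set.mem_Ici.2 hy.le)]
        refine (hd.tendsto_slope.comp htlim').congr' ?_
        filter_upwards [hlt] with n hn
        simp [F, hn.le, slope_def_field]
  rw [← integral_indicator measurableSet_Ici]
  exact tendsto_nhds_unique hlim2 hlim1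

lemma integral_law (s : ℝ → ℝ) :
    ∫ y, s y ∂M.law M.θ0 = ∫ y in Set.Ici (M.g M.θ0), M.f y M.θ0 * s y := by
  rw [law, integral_withDensity_eq_integral_toReal_smul
    (M.measurable_density M.θ0_mem).ennreal_ofReal (ae_of_all _ fun _ => ENNReal.ofReal_lt_top),
    ← integral_indicator measurableSet_Ici]
  congr with y
  rw [ENNReal.toReal_ofReal (M.density_nonneg _ _), density_eq_indicator]
  by_cases hy : M.g M.θ0 ≤ y <;> simp [hy]

lemma integral_score : ∫ y, M.score y ∂M.law M.θ0 = M.lam⁻¹ := by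
  rw [integral_law, ← M.integral_deriv_eq]
  congr with y
  exact mul_div_cancel₀ _ (M.f_pos _ M.θ0_mem y).ne'

lemma lintegral_law {s : ℝ → ENNReal} (hs : Measurable s) :
    ∫⁻ y, s y ∂M.law M.θ0 = ∫⁻ y, ENNReal.ofReal (M.density M.θ0 y) * s y :=
  lintegral_withDensity_eq_lintegral_mul _ (M.measurable_density M.θ0_mem).ennreal_ofReal hs

lemma memLp_score : MemLp M.score 2 (M.law M.θ0) := by
  refine (memLp_two_iff_integrable_sq M.continuous_score.aestronglyMeasurable).2
    ⟨(M.continuous_score.pow 2).aestronglyMeasurable, ?_⟩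
  rw [hasFiniteIntegral_iff_enorm, M.lintegral_law (M.continuous_score.measurable.pow_const 2).enorm]
  refine lt_of_le_of_lt (lintegral_mono fun y => ?_) M.int2
  refine le_trans (le_of_eq ?_) (le_iSup₂_of_le M.θ0 M.θ0_mem
    (le_iSup₂_of_le M.θ0 M.θ0_mem le_rfl))
  rw [Real.enorm_eq_ofReal (sq_nonneg _), ← ENNReal.ofReal_mul (M.density_nonneg _ _), score,
    div_pow, density]
  congr 1
  ring

end BenchmarkModel

namespace BenchmarkModel

variable (M : BenchmarkModel)

/-- The log-likelihood ratio of a single observation. -/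
def logRatio (t y : ℝ) : ℝ := log (M.f y (M.θ0 + t)) - log (M.f y M.θ0)

lemma deriv_log_f {θ : ℝ} (hθ : θ ∈ M.N) (y : ℝ) :
    deriv (fun t => log (M.f y t)) θ = deriv (fun t => M.f y t) θ / M.f y θ :=
  deriv.log ((M.f_smooth y).differentiable two_ne_zero _) (M.f_pos _ hθ y).ne'

lemma deriv_deriv_log_f {θ : ℝ} (hθ : θ ∈ M.N) (y : ℝ) :
    deriv (deriv fun t => log (M.f y t)) θ =
      deriv (deriv fun t => M.f y t) θ / M.f y θ -
        (deriv (fun t => M.f y t) θ) ^ 2 / (M.f y θ) ^ 2 := by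
  have hf := M.f_pos _ hθ y
  have h1 : deriv (fun t => log (M.f y t)) =ᶠ[𝓝 θ]
      fun t => deriv (fun t => M.f y t) t / M.f y t := by
    filter_upwards [M.N_open.mem_nhds hθ] with t ht using M.deriv_log_f ht y
  have h2 : DifferentiableAt ℝ (deriv fun t => M.f y t) θ :=
    ((contDiff_succ_iff_deriv (n := 1)).1 (M.f_smooth y)).2.2.differentiable one_ne_zero θ
  rw [h1.deriv_eq, deriv_fun_div h2 ((M.f_smooth y).differentiable two_ne_zero _) hf.ne']
  field_simp

lemma exists_logRatio_sub_eq {ρ t : ℝ} (hN : Metric.ball M.θ0 ρ ⊆ M.N) (ht : 0 < t) (htρ : t < ρ)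
    (y : ℝ) : ∃ θ ∈ M.N, M.logRatio t y - t * M.score y =
      deriv (deriv fun t => log (M.f y t)) θ * t ^ 2 / 2 := by
  have hsub : Set.Icc M.θ0 (M.θ0 + t) ⊆ M.N := fun x hx => hN <| by
    rw [Metric.mem_ball, Real.dist_eq, abs_of_nonneg (by linarith [hx.1])]
    linarith [hx.2]
  have hcd : ContDiffOn ℝ 2 (fun t => log (M.f y t)) (Set.Icc M.θ0 (M.θ0 + t)) :=
    (M.f_smooth y).contDiffOn.log fun x hx => (M.f_pos _ (hsub hx) y).ne'
  have hlt : M.θ0 < M.θ0 + t := by linarith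
  obtain ⟨c, hc, hc'⟩ := taylor_mean_remainder_lagrange_iteratedDeriv (n := 1) hlt.ne
    (by rw [Set.uIcc_of_le hlt.le, Nat.cast_one, one_add_one_eq_two]; exact hcd)
  have hcN : c ∈ M.N := hsub ⟨by simpa [hlt.le] using hc.1.le, by simpa [hlt.le] using hc.2.le⟩
  refine ⟨c, hcN, ?_⟩
  have hd : derivWithin (fun t => log (M.f y t)) (Set.uIcc M.θ0 (M.θ0 + t)) M.θ0 = M.score y := by
    rw [DifferentiableAt.derivWithin, M.deriv_log_f M.θ0_mem, score]
    · exact ((M.f_smooth y).differentiable two_ne_zero _).log (M.f_pos _ M.θ0_mem y).ne'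
    · exact uniqueDiffOn_Icc (by simp [ht.ne']) _ Set.left_mem_uIcc
  rw [taylorWithinEval_succ, taylor_within_zero_eval, iteratedDerivWithin_one, hd] at hc'
  simp only [iteratedDeriv_succ, iteratedDeriv_zero, add_sub_cancel_left] at hc'
  norm_num at hc'
  rw [logRatio]
  linarith

open scoped ENNReal in
lemma exists_lintegral_remainder_le {ρ : ℝ} (hN : Metric.ball M.θ0 ρ ⊆ M.N) :
    ∃ K : ℝ≥0∞, K ≠ ⊤ ∧ ∀ t, 0 < t → t < ρ →
      ∫⁻ y, ‖M.logRatio t y - t * M.score y‖ₑ ∂M.law M.θ0 ≤ ENNReal.ofReal (t ^ 2) * K := by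
  set v : ℝ → ℝ → ℝ≥0∞ := fun θ y => ENNReal.ofReal
      ((deriv (fun t => M.f y t) θ) ^ 2 / (M.f y θ) ^ 2 *
        (if M.g M.θ0 ≤ y then 1 else 0) * M.f y M.θ0) with hv
  set w : ℝ → ℝ → ℝ≥0∞ := fun θ y => ENNReal.ofReal
      (|deriv (deriv fun t => M.f y t) θ| / M.f y θ *
        (if M.g M.θ0 ≤ y then 1 else 0) * M.f y M.θ0) with hw
  have hind : Measurable fun y : ℝ => if M.g M.θ0 ≤ y then (1 : ℝ) else 0 :=
    Measurable.ite measurableSet_Ici measurable_const measurable_const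
  have hvm : ∀ θ ∈ M.N, Measurable (v θ) := fun θ hθ =>
    (((((M.fθ_cont θ hθ).measurable.pow_const 2).div
      ((M.f_cont θ hθ).measurable.pow_const 2)).mul hind).mul
      (M.f_cont _ M.θ0_mem).measurable).ennreal_ofReal
  set A : ℝ → ℝ≥0∞ := fun y => ⨆ q : {q : ℚ // (q : ℝ) ∈ M.N}, v q y with hA
  have hAm : Measurable A := Measurable.iSup fun q => hvm _ q.2
  have hvA : ∀ θ ∈ M.N, ∀ y, v θ y ≤ A y := fun θ hθ y => by
    have hcl : θ ∈ closure (M.N ∩ Set.range ((↑) : ℚ → ℝ)) :=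
      Rat.denseRange_cast.open_subset_closure_inter M.N_open hθ
    have := mem_closure_iff_nhdsWithin_neBot.1 hcl
    have hcont : ContinuousAt (fun θ => v θ y) θ := by
      refine ENNReal.continuous_ofReal.continuousAt.comp ?_
      have h1 : ContinuousAt (deriv fun t => M.f y t) θ :=
        ((M.f_smooth y).continuous_deriv one_le_two).continuousAt
      have h2 : ContinuousAt (fun t => M.f y t) θ := (M.f_smooth y).continuous.continuousAt
      exact (((h1.pow 2).div (h2.pow 2) (pow_ne_zero 2 (M.f_pos θ hθ y).ne')).mul
        continuousAt_const).mul continuousAt_const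
    refine le_of_tendsto (hcont.tendsto.mono_left (nhdsWithin_le_nhds
      (s := M.N ∩ Set.range ((↑) : ℚ → ℝ)))) ?_
    filter_upwards [self_mem_nhdsWithin] with x hx
    obtain ⟨hxN, q, rfl⟩ := hx
    exact le_iSup (fun q : {q : ℚ // (q : ℝ) ∈ M.N} => v q y) ⟨q, hxN⟩
  have hAfin : ∫⁻ y, A y ≠ ⊤ := ne_top_of_le_ne_top M.int2.ne <| lintegral_mono fun y =>
    le_iSup₂_of_le M.θ0 M.θ0_mem <| iSup_le fun q =>
      le_iSup₂_of_le (f := fun θ (_ : θ ∈ M.N) => v θ y) (q : ℝ) q.2 le_rfl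
  have hBfin : ∫⁻ y, ⨆ θ ∈ M.N, w θ y ≠ ⊤ := ne_top_of_le_ne_top M.int3.ne <|
    lintegral_mono fun y => le_iSup₂_of_le M.θ0 M.θ0_mem le_rfl
  refine ⟨(∫⁻ y, A y) + ∫⁻ y, ⨆ θ ∈ M.N, w θ y, ENNReal.add_ne_top.2 ⟨hAfin, hBfin⟩,
    fun t ht htρ => ?_⟩
  have hmem : M.θ0 + t ∈ M.N := hN (by simpa [abs_of_pos ht] using htρ)
  have hmeas : Measurable fun y => ‖M.logRatio t y - t * M.score y‖ₑ :=
    (((M.f_cont _ hmem).measurable.log.sub (M.f_cont _ M.θ0_mem).measurable.log).sub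
      (M.continuous_score.measurable.const_mul t)).enorm
  rw [M.lintegral_law hmeas, ← lintegral_add_left hAm,
    ← lintegral_const_mul' _ _ ENNReal.ofReal_ne_top]
  refine lintegral_mono fun y => ?_
  obtain ⟨θ, hθ, hθ'⟩ := M.exists_logRatio_sub_eq hN ht htρ y
  refine le_trans ?_ (mul_le_mul_right (add_le_add (hvA θ hθ y)
    (le_iSup₂ (f := fun θ (_ : θ ∈ M.N) => w θ y) θ hθ)) _)
  have hf := M.f_pos θ hθ y
  have hf0 := M.density_nonneg M.θ0 y
  have hi : (0 : ℝ) ≤ if M.g M.θ0 ≤ y then 1 else 0 := by positivity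
  have hf00 := (M.f_pos _ M.θ0_mem y).le
  rw [hθ', M.deriv_deriv_log_f hθ, Real.enorm_eq_ofReal_abs, ← ENNReal.ofReal_mul hf0,
    hv, hw, ← ENNReal.ofReal_add (by positivity) (by positivity),
    ← ENNReal.ofReal_mul (sq_nonneg _)]
  refine ENNReal.ofReal_le_ofReal ?_
  set a := deriv (deriv fun t => M.f y t) θ
  set b := (deriv (fun t => M.f y t) θ) ^ 2 / (M.f y θ) ^ 2
  have hb : 0 ≤ b := by positivity
  have h1 : |(a / M.f y θ - b) * t ^ 2 / 2| ≤ (|a| / M.f y θ + b) * t ^ 2 := by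
    rw [mul_div_assoc, abs_mul, abs_of_nonneg (by positivity : 0 ≤ t ^ 2 / 2)]
    have h2 : |a / M.f y θ - b| ≤ |a| / M.f y θ + b := by
      refine (abs_sub _ _).trans ?_
      rw [abs_div, abs_of_pos hf, abs_of_nonneg hb]
    exact mul_le_mul h2 (by linarith [sq_nonneg t]) (by positivity) (by positivity)
  calc M.density M.θ0 y * _ ≤ M.density M.θ0 y * ((|a| / M.f y θ + b) * t ^ 2) :=
        mul_le_mul_of_nonneg_left h1 hf0
    _ = _ := by rw [density]; ring

end BenchmarkModel

open scoped ENNReal in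
/-- A weak law of large numbers for row sums `∑ i, r n (y i)` whose summands are, up to a
remainder of order `n⁻²` in `L¹`, equal to `(a / n) * s (y i)`. -/
lemma tendsto_pi_abs_sum_sub_ge {Ω : Type*} [MeasurableSpace Ω] {μ : Measure Ω}
    [IsProbabilityMeasure μ] {s : Ω → ℝ} (hs : MemLp s 2 μ) (hsm : Measurable s)
    {r : ℕ → Ω → ℝ} {a : ℝ} {K : ℝ≥0∞} (hK : K ≠ ⊤)
    (hr : ∀ᶠ n in atTop, Measurable (r n) ∧
      ∫⁻ y, ‖r n y - a / n * s y‖ₑ ∂μ ≤ ENNReal.ofReal ((a / n) ^ 2) * K)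
    {δ : ℝ} (hδ : 0 < δ) :
    Tendsto (fun n : ℕ => Measure.pi (fun _ : Fin n => μ)
      {y | δ ≤ |∑ i, r n (y i) - a * ∫ x, s x ∂μ|}) atTop (𝓝 0) := by
  have hlim : Tendsto (fun n : ℕ => ENNReal.ofReal (a ^ 2 / n) *
      (ENNReal.ofReal (ProbabilityTheory.variance s μ / (δ / 2) ^ 2) +
        K / ENNReal.ofReal (δ / 2))) atTop (𝓝 0) := by
    have h1 : Tendsto (fun n : ℕ => ENNReal.ofReal (a ^ 2 / n)) atTop (𝓝 0) := by
      simpa using ENNReal.tendsto_ofReal (tendsto_const_div_atTop_nhds_zero_nat (a ^ 2))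
    have hδ' : ENNReal.ofReal (δ / 2) ≠ 0 := by simpa using hδ
    simpa using ENNReal.Tendsto.mul_const h1 (Or.inr (ENNReal.add_ne_top.2
      ⟨ENNReal.ofReal_ne_top, ENNReal.div_ne_top hK hδ'⟩))
  refine tendsto_of_tendsto_of_tendsto_of_le_of_le' tendsto_const_nhds hlim
    (Eventually.of_forall fun _ => zero_le) ?_
  filter_upwards [hr, eventually_gt_atTop 0] with n hrn hn
  obtain ⟨hrm, hrn⟩ := hrn
  have hn0 : (0 : ℝ) < n := Nat.cast_pos.2 hn
  set Q := Measure.pi (fun _ : Fin n => μ) with hQ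
  set X : (Fin n → Ω) → ℝ := ∑ i : Fin n, fun y => a / n * s (y i) with hX
  have hXL : ∀ _i : Fin n, MemLp (fun x => a / n * s x) 2 μ := fun _ => hs.const_mul (a / n)
  have hXmem : MemLp X 2 Q := memLp_finsetSum' _ fun i _ =>
    (hXL i).comp_measurePreserving (measurePreserving_eval (fun _ => μ) i)
  have hXint : ∫ y, X y ∂Q = a * ∫ x, s x ∂μ := by
    simp only [hX, Finset.sum_apply]
    have hint : ∀ i : Fin n, Integrable (fun y : Fin n → Ω => a / n * s (y i)) Q := fun i =>
      ((hXL i).comp_measurePreserving (measurePreserving_eval (fun _ => μ) i)).integrable one_le_two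
    rw [integral_finsetSum _ fun i _ => hint i]
    have : ∀ i : Fin n, ∫ y, a / n * s (y i) ∂Q = a / n * ∫ x, s x ∂μ := fun i => by
      rw [integral_const_mul, hQ, integral_comp_eval (μ := fun _ : Fin n => μ) (i := i)
        (f := s) hs.1]
    rw [Finset.sum_congr rfl fun i _ => this i]
    simp
    field_simp
  have hXvar : ProbabilityTheory.variance X Q = a ^ 2 / n * ProbabilityTheory.variance s μ := by
    rw [hX, hQ, ProbabilityTheory.variance_sum_pi hXL]
    simp only [ProbabilityTheory.variance_const_mul]
    simp
    field_simp
  set Y : (Fin n → Ω) → ℝ≥0∞ := fun y => ∑ i : Fin n, ‖r n (y i) - a / n * s (y i)‖ₑ with hY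
  have hRm : Measurable fun x => ‖r n x - a / n * s x‖ₑ := (hrm.sub (hsm.const_mul _)).enorm
  have hRmi : ∀ i : Fin n, Measurable fun y : Fin n → Ω => ‖r n (y i) - a / n * s (y i)‖ₑ :=
    fun i => hRm.comp (measurable_pi_apply i)
  have hYint : ∫⁻ y, Y y ∂Q ≤ ENNReal.ofReal (a ^ 2 / n) * K := by
    simp only [hY]
    rw [lintegral_finsetSum _ fun i _ => hRmi i]
    calc ∑ i : Fin n, ∫⁻ y, ‖r n (y i) - a / n * s (y i)‖ₑ ∂Q
        = ∑ i : Fin n, ∫⁻ x, ‖r n x - a / n * s x‖ₑ ∂μ := Finset.sum_congr rfl fun i _ =>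
          (measurePreserving_eval (fun _ => μ) i).lintegral_comp hRm
      _ ≤ ∑ i : Fin n, ENNReal.ofReal ((a / n) ^ 2) * K := Finset.sum_le_sum fun _ _ => hrn
      _ = ENNReal.ofReal (a ^ 2 / n) * K := by
        rw [Finset.sum_const, Finset.card_univ, Fintype.card_fin, nsmul_eq_mul, ← mul_assoc,
          ← ENNReal.ofReal_natCast, ← ENNReal.ofReal_mul hn0.le]
        congr 2
        field_simp
  have hsub : {y : Fin n → Ω | δ ≤ |∑ i, r n (y i) - a * ∫ x, s x ∂μ|} ⊆
      {y | δ / 2 ≤ |X y - (∫ y, X y ∂Q)|} ∪ {y | ENNReal.ofReal (δ / 2) ≤ Y y} := by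
    intro y hy
    by_contra hcon
    simp only [Set.mem_union, Set.mem_ofPred_eq, not_or, not_le] at hcon hy
    have h1 : |∑ i, (r n (y i) - a / n * s (y i))| < δ / 2 := by
      refine (ENNReal.ofReal_lt_ofReal_iff (by linarith)).1 (lt_of_le_of_lt ?_ hcon.2)
      rw [← Real.enorm_eq_ofReal_abs]
      exact enorm_sum_le _ _
    have h2 := hcon.1
    rw [hXint, hX, Finset.sum_apply] at h2
    rw [Finset.sum_sub_distrib] at h1
    rw [abs_lt] at h1 h2
    rcases le_abs.1 hy with h | h <;> linarith [h1.1, h1.2, h2.1, h2.2]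
  calc Q _ ≤ Q {y | δ / 2 ≤ |X y - (∫ y, X y ∂Q)|} + Q {y | ENNReal.ofReal (δ / 2) ≤ Y y} :=
        (measure_mono hsub).trans (measure_union_le _ _)
    _ ≤ ENNReal.ofReal (ProbabilityTheory.variance X Q / (δ / 2) ^ 2) +
        (∫⁻ y, Y y ∂Q) / ENNReal.ofReal (δ / 2) :=
        add_le_add (ProbabilityTheory.meas_ge_le_variance_div_sq hXmem (by linarith))
          (meas_ge_le_lintegral_div
            (Finset.measurable_sum _ fun i _ => hRmi i).aemeasurable
            (by simpa using hδ) ENNReal.ofReal_ne_top)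
    _ ≤ _ := by
      rw [hXvar, mul_div_assoc, ENNReal.ofReal_mul (by positivity), mul_add]
      gcongr
      rw [← mul_div_assoc]
      gcongr

namespace BenchmarkModel

variable (M : BenchmarkModel)

/-- The log-likelihood ratio between `θ0 + a / n` and `θ0` of a sample of size `n`. -/
def sumLogRatio (n : ℕ) (a : ℝ) (y : Fin n → ℝ) : ℝ := ∑ i, M.logRatio (a / n) (y i)

/-- The samples lying in the support of `P_{θ0 + a / n}`. -/
def supportSet (n : ℕ) (a : ℝ) : Set (Fin n → ℝ) := {y | ∀ i, M.g (M.θ0 + a / n) ≤ y i}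

/-- The samples whose log-likelihood ratio is within `δ` of its limit. -/
def nearSet (n : ℕ) (a δ : ℝ) : Set (Fin n → ℝ) := {y | |M.sumLogRatio n a y - a / M.lam| < δ}

lemma mem_supportSet {n : ℕ} {a : ℝ} {y : Fin n → ℝ} :
    y ∈ M.supportSet n a ↔ ∀ i, M.g (M.θ0 + a / n) ≤ y i := Iff.rfl

lemma mem_nearSet {n : ℕ} {a δ : ℝ} {y : Fin n → ℝ} :
    y ∈ M.nearSet n a δ ↔ |M.sumLogRatio n a y - a / M.lam| < δ := Iff.rfl

lemma eventually_local_mem {ρ : ℝ} (hρ : 0 < ρ) (a : ℝ) :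
    ∀ᶠ n : ℕ in atTop, M.θ0 + a / n ∈ Metric.ball M.θ0 ρ := by
  have h : Tendsto (fun n : ℕ => M.θ0 + a / n) atTop (𝓝 M.θ0) := by
    simpa using (tendsto_const_div_atTop_nhds_zero_nat a).const_add M.θ0
  exact h.eventually (Metric.ball_mem_nhds _ hρ)

lemma eventually_local_mem_N (a : ℝ) : ∀ᶠ n : ℕ in atTop, M.θ0 + a / n ∈ M.N := by
  obtain ⟨ρ, hρ, hN, -⟩ := M.exists_ball_subset_monotoneOn
  filter_upwards [M.eventually_local_mem hρ a] with n hn using hN hn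

lemma eventually_g_local_le {a b : ℝ} (hab : a ≤ b) :
    ∀ᶠ n : ℕ in atTop, M.g (M.θ0 + a / n) ≤ M.g (M.θ0 + b / n) := by
  obtain ⟨ρ, hρ, -, hg⟩ := M.exists_ball_subset_monotoneOn
  filter_upwards [M.eventually_local_mem hρ a, M.eventually_local_mem hρ b] with n ha hb
  exact hg ha hb (by gcongr)

lemma eventually_g_le_local {a : ℝ} (ha : 0 ≤ a) :
    ∀ᶠ n : ℕ in atTop, M.g M.θ0 ≤ M.g (M.θ0 + a / n) := by
  simpa using M.eventually_g_local_le ha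

lemma measurableSet_supportSet (n : ℕ) (a : ℝ) : MeasurableSet (M.supportSet n a) := by
  have : M.supportSet n a = ⋂ i, {y | M.g (M.θ0 + a / n) ≤ y i} := by
    ext y; simp [supportSet]
  rw [this]
  exact MeasurableSet.iInter fun i => measurableSet_le measurable_const (measurable_pi_apply i)

lemma measurable_logRatio {t : ℝ} (ht : M.θ0 + t ∈ M.N) : Measurable (M.logRatio t) :=
  (M.f_cont _ ht).measurable.log.sub (M.f_cont _ M.θ0_mem).measurable.log

lemma measurable_sumLogRatio {n : ℕ} {a : ℝ} (h : M.θ0 + a / n ∈ M.N) :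
    Measurable (M.sumLogRatio n a) :=
  Finset.measurable_sum _ fun i _ => (M.measurable_logRatio h).comp (measurable_pi_apply i)

lemma measurableSet_nearSet {n : ℕ} {a : ℝ} (h : M.θ0 + a / n ∈ M.N) (δ : ℝ) :
    MeasurableSet (M.nearSet n a δ) :=
  measurableSet_lt ((M.measurable_sumLogRatio h).sub_const _).abs measurable_const

lemma prod_f_eq {n : ℕ} {a : ℝ} (h : M.θ0 + a / n ∈ M.N) (y : Fin n → ℝ) :
    ∏ i, M.f (y i) (M.θ0 + a / n) / M.f (y i) M.θ0 = exp (M.sumLogRatio n a y) := by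
  rw [sumLogRatio, exp_sum]
  refine Finset.prod_congr rfl fun i _ => ?_
  rw [logRatio, exp_sub, exp_log (M.f_pos _ h _), exp_log (M.f_pos _ M.θ0_mem _)]

lemma Z_zero_eq {n : ℕ} {a : ℝ} (h : M.θ0 + a / n ∈ M.N)
    (hg : M.g M.θ0 ≤ M.g (M.θ0 + a / n)) :
    M.Z n 0 a = (M.supportSet n a).indicator fun y => exp (M.sumLogRatio n a y) := by
  ext y
  simp only [Z, zero_div, add_zero, M.prod_f_eq h]
  by_cases hy : y ∈ M.supportSet n a
  · have hy' := M.mem_supportSet.1 hy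
    rw [Set.indicator_of_mem hy, if_pos fun i => hg.trans (hy' i), if_pos hy', one_mul]
  · rw [Set.indicator_of_notMem hy, if_neg (mt M.mem_supportSet.2 hy), zero_mul, ite_self]

lemma measurable_Z_zero {n : ℕ} {a : ℝ} (h : M.θ0 + a / n ∈ M.N)
    (hg : M.g M.θ0 ≤ M.g (M.θ0 + a / n)) : Measurable (M.Z n 0 a) := by
  rw [M.Z_zero_eq h hg]
  exact (M.measurable_sumLogRatio h).exp.indicator (M.measurableSet_supportSet n a)

lemma Z_zero_nonneg {n : ℕ} {a : ℝ} (h : M.θ0 + a / n ∈ M.N)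
    (hg : M.g M.θ0 ≤ M.g (M.θ0 + a / n)) (y : Fin n → ℝ) : 0 ≤ M.Z n 0 a y := by
  rw [M.Z_zero_eq h hg]
  exact Set.indicator_nonneg (fun _ _ => (exp_pos _).le) y

lemma P_local_eq_withDensity {n : ℕ} {a : ℝ} (h : M.θ0 + a / n ∈ M.N)
    (hg : M.g M.θ0 ≤ M.g (M.θ0 + a / n)) :
    M.P n (M.θ0 + a / n) = (M.P n M.θ0).withDensity fun y => ENNReal.ofReal (M.Z n 0 a y) := by
  have hm : Measurable fun y : Fin n → ℝ =>
      ENNReal.ofReal (∏ i, M.f (y i) M.θ0 * if M.g M.θ0 ≤ y i then 1 else 0) :=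
    (Finset.measurable_prod _ fun i _ => (M.measurable_density M.θ0_mem).comp
      (measurable_pi_apply i)).ennreal_ofReal
  rw [P, P, ← withDensity_mul _ hm (M.measurable_Z_zero h hg).ennreal_ofReal]
  congr 1
  ext y
  have hnn : 0 ≤ ∏ i, M.f (y i) M.θ0 * (if M.g M.θ0 ≤ y i then 1 else 0) :=
    Finset.prod_nonneg fun i _ => M.density_nonneg _ _
  rw [Pi.mul_apply, ← ENNReal.ofReal_mul hnn, M.Z_zero_eq h hg]
  congr 1
  by_cases hy : y ∈ M.supportSet n a
  · have hy' := M.mem_supportSet.1 hy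
    rw [Set.indicator_of_mem hy, ← M.prod_f_eq h, ← Finset.prod_mul_distrib]
    refine Finset.prod_congr rfl fun i _ => ?_
    rw [if_pos (hy' i), if_pos (hg.trans (hy' i)), mul_one, mul_one,
      mul_div_cancel₀ _ (M.f_pos _ M.θ0_mem _).ne']
  · rw [Set.indicator_of_notMem hy, mul_zero]
    rw [mem_supportSet] at hy
    push Not at hy
    obtain ⟨i, hi⟩ := hy
    exact Finset.prod_eq_zero (Finset.mem_univ i) (by rw [if_neg hi.not_ge, mul_zero])

lemma _root_.measurableSet_setOf_exists_lt (n : ℕ) (c : ℝ) :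
    MeasurableSet {y : Fin n → ℝ | ∃ i, y i < c} := by
  have : {y : Fin n → ℝ | ∃ i, y i < c} = ⋃ i, {y | y i < c} := by ext; simp
  rw [this]
  exact MeasurableSet.iUnion fun i => measurableSet_lt (measurable_pi_apply i) measurable_const

lemma P_setOf_exists_lt (n : ℕ) (θ : ℝ) : M.P n θ {y | ∃ i, y i < M.g θ} = 0 := by
  have hm := measurableSet_setOf_exists_lt n (M.g θ)
  rw [P, withDensity_apply _ hm]
  refine (setLIntegral_congr_fun hm fun y hy => ?_).trans lintegral_zero
  obtain ⟨i, hi⟩ := hy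
  rw [Finset.prod_eq_zero (Finset.mem_univ i) (by rw [if_neg hi.not_ge, mul_zero]),
    ENNReal.ofReal_zero]

lemma tendsto_P_supportSet {a : ℝ} (ha : 0 < a) :
    Tendsto (fun n => (M.P n M.θ0).real (M.supportSet n a)) atTop (𝓝 (exp (-(a / M.lam)))) := by
  set I : ℝ → ℝ := fun θ => ∫ y in (M.g M.θ0)..(M.g θ), M.f y M.θ0 with hI
  have hlim : Tendsto (fun n : ℕ => (n : ℝ) * -I (M.θ0 + a / n)) atTop (𝓝 (-(a / M.lam))) := by
    have h1 : Tendsto (fun n : ℕ => M.θ0 + a / n) atTop (𝓝[≠] M.θ0) := by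
      refine tendsto_nhdsWithin_iff.2 ⟨?_, ?_⟩
      · simpa using (tendsto_const_div_atTop_nhds_zero_nat a).const_add M.θ0
      · filter_upwards [eventually_gt_atTop 0] with n hn
        simpa using ⟨ha.ne', hn.ne'⟩
    have h2 := ((M.hasDerivAt_boundary_integral.tendsto_slope.comp h1).const_mul a).neg
    rw [← div_eq_mul_inv] at h2
    refine h2.congr' ?_
    filter_upwards [eventually_gt_atTop 0] with n hn
    have hn' : (n : ℝ) ≠ 0 := Nat.cast_ne_zero.2 hn.ne'
    simp only [Function.comp_apply, slope_def_field, add_sub_cancel_left,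
      intervalIntegral.integral_same, sub_zero, hI]
    field_simp
  refine (Real.tendsto_one_add_pow_exp_of_tendsto hlim).congr' ?_
  filter_upwards [M.eventually_g_le_local ha.le] with n hn
  have hset : M.supportSet n a = Set.univ.pi fun _ => Set.Ici (M.g (M.θ0 + a / n)) := by
    ext y; simp [supportSet, Pi.le_def]
  have hlaw : (M.law M.θ0).real (Set.Ici (M.g (M.θ0 + a / n))) = 1 + -I (M.θ0 + a / n) := by
    rw [Measure.real, M.law_apply _ measurableSet_Ici,
      ENNReal.toReal_ofReal (integral_nonneg fun y => M.density_nonneg _ _), ← sub_eq_add_neg,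
      ← M.integral_Ici hn]
    refine setIntegral_congr_fun measurableSet_Ici fun y hy => ?_
    simp [density, hn.trans hy]
  rw [Measure.real, P_eq_pi, hset, Measure.pi_pi, ENNReal.toReal_prod, Finset.prod_const,
    Finset.card_univ, Fintype.card_fin, ← hlaw, Measure.real]

lemma tendsto_P_compl_nearSet {a δ : ℝ} (ha : 0 < a) (hδ : 0 < δ) :
    Tendsto (fun n => (M.P n M.θ0).real (M.nearSet n a δ)ᶜ) atTop (𝓝 0) := by
  obtain ⟨ρ, hρ, hN, -⟩ := M.exists_ball_subset_monotoneOn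
  obtain ⟨K, hK, hrem⟩ := M.exists_lintegral_remainder_le hN
  have h := tendsto_pi_abs_sum_sub_ge M.memLp_score M.continuous_score.measurable
    (r := fun n => M.logRatio (a / n)) (a := a) hK ?_ hδ
  · rw [M.integral_score, ← div_eq_mul_inv] at h
    have h' := (ENNReal.tendsto_toReal ENNReal.zero_ne_top).comp h
    refine (h'.congr fun n => ?_)
    rw [Function.comp_apply, Measure.real, P_eq_pi]
    congr 2
    ext y
    simp [nearSet, sumLogRatio]
  · filter_upwards [M.eventually_local_mem hρ a, eventually_gt_atTop 0] with n hn hn0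
    have hpos : 0 < a / n := div_pos ha (Nat.cast_pos.2 hn0)
    refine ⟨M.measurable_logRatio (hN hn), hrem _ hpos ?_⟩
    simpa [abs_of_pos ha] using hn

lemma exp_mul_P_le {n : ℕ} {a δ : ℝ} (h : M.θ0 + a / n ∈ M.N)
    (hg : M.g M.θ0 ≤ M.g (M.θ0 + a / n)) {B : Set (Fin n → ℝ)} (hB : MeasurableSet B)
    (hBs : B ⊆ M.supportSet n a) (hBn : B ⊆ M.nearSet n a δ) :
    exp (a / M.lam - δ) * (M.P n M.θ0).real B ≤ (M.P n (M.θ0 + a / n)).real B := by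
  have key : ENNReal.ofReal (exp (a / M.lam - δ)) * M.P n M.θ0 B ≤ M.P n (M.θ0 + a / n) B := by
    rw [M.P_local_eq_withDensity h hg, withDensity_apply _ hB, ← setLIntegral_const]
    refine setLIntegral_mono' hB fun y hy => ENNReal.ofReal_le_ofReal ?_
    rw [M.Z_zero_eq h hg, Set.indicator_of_mem (hBs hy)]
    have := (abs_lt.1 (M.mem_nearSet.1 (hBn hy))).1
    exact exp_le_exp.2 (by linarith)
  have := ENNReal.toReal_mono (measure_ne_top _ _) key
  rwa [ENNReal.toReal_mul, ENNReal.toReal_ofReal (exp_pos _).le] at this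

lemma eventually_P_local_compl_nearSet_lt {a δ : ℝ} (ha : 0 < a) (hδ : 0 < δ) {c : ℝ}
    (hc : 1 - exp (-δ) < c) :
    ∀ᶠ n : ℕ in atTop, (M.P n (M.θ0 + a / n)).real (M.nearSet n a δ)ᶜ < c := by
  have hlim : Tendsto (fun n : ℕ => 1 - exp (a / M.lam - δ) *
      ((M.P n M.θ0).real (M.supportSet n a) - (M.P n M.θ0).real (M.nearSet n a δ)ᶜ)) atTop
      (𝓝 (1 - exp (-δ))) := by
    have h := (((M.tendsto_P_supportSet ha).sub (M.tendsto_P_compl_nearSet ha hδ)).const_mul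
      (exp (a / M.lam - δ))).const_sub 1
    rw [sub_zero, ← exp_add] at h
    convert h using 4
    ring
  filter_upwards [hlim.eventually_lt_const hc, M.eventually_local_mem_N a,
    M.eventually_g_le_local ha.le] with n hn hN hg
  refine lt_of_le_of_lt ?_ hn
  have hm := M.measurableSet_nearSet hN δ
  have h1 := M.exp_mul_P_le hN hg ((M.measurableSet_supportSet n a).inter hm)
    Set.inter_subset_left Set.inter_subset_right
  have h2 : (M.P n M.θ0).real (M.supportSet n a) ≤
      (M.P n M.θ0).real (M.supportSet n a ∩ M.nearSet n a δ) +
        (M.P n M.θ0).real (M.nearSet n a δ)ᶜ := by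
    refine (measureReal_mono fun y hy => ?_).trans (measureReal_union_le _ _)
    by_cases hy' : y ∈ M.nearSet n a δ
    · exact Or.inl ⟨hy, hy'⟩
    · exact Or.inr hy'
  have h3 : (M.P n (M.θ0 + a / n)).real (M.supportSet n a ∩ M.nearSet n a δ) ≤
      (M.P n (M.θ0 + a / n)).real (M.nearSet n a δ) := measureReal_mono Set.inter_subset_right
  rw [probReal_compl_eq_one_sub hm]
  have h4 := mul_le_mul_of_nonneg_left (sub_le_iff_le_add.2 h2) (exp_pos (a / M.lam - δ)).le
  linarith

lemma integral_P_local_le {n : ℕ} {a δ : ℝ} (h : M.θ0 + a / n ∈ M.N)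
    (hg : M.g M.θ0 ≤ M.g (M.θ0 + a / n)) {ψ : (Fin n → ℝ) → ℝ} (hψ : Measurable ψ)
    (hψ01 : ∀ y, ψ y ∈ Set.Icc (0 : ℝ) 1) :
    ∫ y, ψ y ∂M.P n (M.θ0 + a / n) ≤ exp (a / M.lam + δ) * ∫ y, ψ y ∂M.P n M.θ0 +
      (M.P n (M.θ0 + a / n)).real (M.nearSet n a δ)ᶜ := by
  have hm := M.measurableSet_nearSet h δ
  have hint : ∀ θ, Integrable ψ (M.P n θ) := fun θ =>
    Integrable.of_bound hψ.aestronglyMeasurable 1 (ae_of_all _ fun y => by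
      rw [norm_of_nonneg (hψ01 y).1]; exact (hψ01 y).2)
  rw [← integral_add_compl hm (hint _)]
  refine add_le_add ?_ ?_
  · rw [← integral_const_mul, M.P_local_eq_withDensity h hg,
      setIntegral_withDensity_eq_setIntegral_toReal_smul
        (M.measurable_Z_zero h hg).ennreal_ofReal
        (ae_of_all _ fun _ => ENNReal.ofReal_lt_top) _ hm]
    rw [← integral_indicator hm]
    refine integral_mono_of_nonneg (ae_of_all _ fun y => ?_) ((hint _).const_mul _)
      (ae_of_all _ fun y => ?_)
    · exact Set.indicator_nonneg
        (fun y _ => mul_nonneg ENNReal.toReal_nonneg (hψ01 y).1) y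
    · refine Set.indicator_le' (fun y hy => ?_)
        (fun y _ => mul_nonneg (exp_pos _).le (hψ01 y).1) y
      rw [ENNReal.toReal_ofReal (M.Z_zero_nonneg h hg y), smul_eq_mul]
      refine mul_le_mul_of_nonneg_right ?_ (hψ01 y).1
      rw [M.Z_zero_eq h hg]
      refine Set.indicator_le' (f := fun y => exp (M.sumLogRatio n a y))
        (g := fun y => exp (M.sumLogRatio n a y)) (fun _ _ => le_rfl)
        (fun _ _ => (exp_pos _).le) y |>.trans (exp_le_exp.2 ?_)
      linarith [(abs_lt.1 (M.mem_nearSet.1 hy)).2]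
  · calc ∫ y in (M.nearSet n a δ)ᶜ, ψ y ∂M.P n (M.θ0 + a / n)
        ≤ ∫ y in (M.nearSet n a δ)ᶜ, 1 ∂M.P n (M.θ0 + a / n) :=
          setIntegral_mono (hint _).integrableOn (integrable_const _).integrableOn
            fun y => (hψ01 y).2
      _ = _ := by simp

end BenchmarkModel

namespace BenchmarkModel

variable (M : BenchmarkModel)

lemma integral_P_mem_Icc {n : ℕ} {θ : ℝ} {ψ : (Fin n → ℝ) → ℝ}
    (hψ : ∀ y, ψ y ∈ Set.Icc (0 : ℝ) 1) : ∫ y, ψ y ∂M.P n θ ∈ Set.Icc (0 : ℝ) 1 := by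
  refine ⟨integral_nonneg fun y => (hψ y).1, ?_⟩
  refine (integral_mono_of_nonneg (ae_of_all _ fun y => (hψ y).1) (integrable_const 1)
    (ae_of_all _ fun y => (hψ y).2)).trans ?_
  simp

/-- The set on which the test at level `α = exp (-b / λ)` rejects. -/
def rejectionSet (n : ℕ) (b ε α : ℝ) : Set (Fin n → ℝ) :=
  {y | (1 - ε) / α ≤ M.Z n 0 b y ∨ ∃ i, y i < M.g M.θ0}

lemma phiPlus_eq_indicator {α ε : ℝ} (hα : 0 < α) (hε : 0 < ε) (n : ℕ) :
    M.phiPlus n (-M.lam * log α) ε α =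
      (M.rejectionSet n (-M.lam * log α) ε α).indicator fun _ => 1 := by
  have hlam := M.lam_pos.ne'
  have h1 : exp (-M.lam * log α / M.lam) = α⁻¹ := by
    rw [show -M.lam * log α / M.lam = -log α by field_simp, exp_neg, exp_log hα]
  have h2 : exp (-(-M.lam * log α) / M.lam) = α := by
    rw [show -(-M.lam * log α) / M.lam = log α by field_simp, exp_log hα]
  have h3 : α⁻¹ * (1 - ε) ≤ α⁻¹ * (1 + ε) := by
    have := inv_pos.2 hα
    gcongr
    linarith
  rw [phiPlus, if_pos h2.ge]
  ext y
  simp only [rejectionSet, Set.indicator_apply, Set.mem_ofPred_eq, Set.mem_Icc, div_eq_inv_mul]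
  grind

lemma measurableSet_rejectionSet {n : ℕ} {b : ℝ} (h : M.θ0 + b / n ∈ M.N)
    (hg : M.g M.θ0 ≤ M.g (M.θ0 + b / n)) (ε α : ℝ) :
    MeasurableSet (M.rejectionSet n b ε α) :=
  (measurableSet_le measurable_const (M.measurable_Z_zero h hg)).union
    (measurableSet_setOf_exists_lt n (M.g M.θ0))

lemma P_rejectionSet_le {n : ℕ} {b ε α : ℝ} (h : M.θ0 + b / n ∈ M.N)
    (hg : M.g M.θ0 ≤ M.g (M.θ0 + b / n)) (hα : 0 < α) (hε : ε < 1) :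
    (M.P n M.θ0).real (M.rejectionSet n b ε α) ≤ (M.P n M.θ0).real (M.supportSet n b) := by
  have hsub : M.rejectionSet n b ε α ⊆
      M.supportSet n b ∪ {y | ∃ i, y i < M.g M.θ0} := by
    rintro y (hy | hy)
    · refine Or.inl (by_contra fun hy' => ?_)
      rw [M.Z_zero_eq h hg, Set.indicator_of_notMem hy'] at hy
      exact (div_pos (sub_pos.2 hε) hα).not_ge hy
    · exact Or.inr hy
  refine (measureReal_mono hsub).trans ((measureReal_union_le _ _).trans ?_)
  simp [Measure.real, M.P_setOf_exists_lt]

lemma inter_subset_rejectionSet {n : ℕ} {b δ ε α : ℝ} (h : M.θ0 + b / n ∈ M.N)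
    (hg : M.g M.θ0 ≤ M.g (M.θ0 + b / n)) (hα : 1 - ε ≤ α * exp (b / M.lam - δ)) (hα0 : 0 < α) :
    M.supportSet n b ∩ M.nearSet n b δ ⊆ M.rejectionSet n b ε α := by
  rintro y ⟨hs, hn⟩
  left
  rw [M.Z_zero_eq h hg, Set.indicator_of_mem hs, div_le_iff₀' hα0]
  refine hα.trans (mul_le_mul_of_nonneg_left (exp_le_exp.2 ?_) hα0.le)
  linarith [(abs_lt.1 (M.mem_nearSet.1 hn)).1]

lemma neg_lam_mul_log_pos {α : ℝ} (hα : α ∈ Set.Ioo (0 : ℝ) 1) : 0 < -M.lam * log α := by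
  have := mul_neg_of_pos_of_neg M.lam_pos (log_neg hα.1 hα.2)
  linarith

lemma eventually_integral_phiPlus {α ε : ℝ} (hα : α ∈ Set.Ioo (0 : ℝ) 1)
    (hε : ε ∈ Set.Ioo (0 : ℝ) 1) : ∀ᶠ n : ℕ in atTop, ∀ θ,
      ∫ y, M.phiPlus n (-M.lam * log α) ε α y ∂M.P n θ =
        (M.P n θ).real (M.rejectionSet n (-M.lam * log α) ε α) := by
  filter_upwards [M.eventually_local_mem_N (-M.lam * log α),
    M.eventually_g_le_local (M.neg_lam_mul_log_pos hα).le] with n hN hg θ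
  rw [M.phiPlus_eq_indicator hα.1 hε.1,
    integral_indicator_const _ (M.measurableSet_rejectionSet hN hg ε α), smul_eq_mul, mul_one]

lemma phiPlus_mem_Icc {α ε : ℝ} (hα : 0 < α) (hε : 0 < ε) (n : ℕ) (y : Fin n → ℝ) :
    M.phiPlus n (-M.lam * log α) ε α y ∈ Set.Icc (0 : ℝ) 1 := by
  rw [M.phiPlus_eq_indicator hα hε, Set.indicator_apply]
  split_ifs <;> simp

lemma limsup_integral_phiPlus_le {α ε : ℝ} (hα : α ∈ Set.Ioo (0 : ℝ) 1)
    (hε : ε ∈ Set.Ioo (0 : ℝ) 1) :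
    limsup (fun n : ℕ => ∫ y, M.phiPlus n (-M.lam * log α) ε α y ∂M.P n M.θ0) atTop ≤ α := by
  have hb := M.neg_lam_mul_log_pos hα
  have hlim := M.tendsto_P_supportSet hb
  have hval : exp (-(-M.lam * log α / M.lam)) = α := by
    have hlam := M.lam_pos.ne'
    rw [show -(-M.lam * log α / M.lam) = log α by field_simp, exp_log hα.1]
  rw [hval] at hlim
  refine (limsup_le_limsup ?_ ?_ hlim.isBoundedUnder_le).trans_eq hlim.limsup_eq
  · filter_upwards [M.eventually_integral_phiPlus hα hε, M.eventually_local_mem_N _,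
      M.eventually_g_le_local hb.le] with n hn hN hg
    rw [hn]
    exact M.P_rejectionSet_le hN hg hα.1 hε.2
  · exact (isBoundedUnder_of ⟨0, fun n => (M.integral_P_mem_Icc
      (M.phiPlus_mem_Icc hα.1 hε.1 n)).1⟩).isCoboundedUnder_le

/-- Asymptotic lower bound for the power of the test against `θ0 + h / n`. -/
lemma le_liminf_integral_phiPlus {α ε h k : ℝ} (hα : α ∈ Set.Ioo (0 : ℝ) 1)
    (hε : ε ∈ Set.Ioo (0 : ℝ) 1) (hh : 0 < h) (hk : h ≤ k) (hbk : -M.lam * log α ≤ k) :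
    exp (h / M.lam - k / M.lam) ≤ liminf
      (fun n : ℕ => ∫ y, M.phiPlus n (-M.lam * log α) ε α y ∂M.P n (M.θ0 + h / n)) atTop := by
  set b := -M.lam * log α with hb_def
  have hb : 0 < b := M.neg_lam_mul_log_pos hα
  have hαb : α * exp (b / M.lam) = 1 := by
    have hlam := M.lam_pos.ne'
    rw [show b / M.lam = -log α by rw [hb_def]; field_simp, exp_neg, exp_log hα.1,
      mul_inv_cancel₀ hα.1.ne']
  have hcont : Tendsto (fun δ : ℝ => exp (h / M.lam - δ) * exp (-(k / M.lam))) (𝓝[>] 0)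
      (𝓝 (exp (h / M.lam - k / M.lam))) := by
    have : Continuous fun δ : ℝ => exp (h / M.lam - δ) * exp (-(k / M.lam)) := by fun_prop
    convert (this.tendsto 0).mono_left nhdsWithin_le_nhds using 2
    rw [sub_zero, ← exp_add, sub_eq_add_neg]
  have hsmall : ∀ᶠ δ : ℝ in 𝓝[>] 0, 1 - ε < exp (-δ) := by
    have : Tendsto (fun δ : ℝ => exp (-δ)) (𝓝[>] 0) (𝓝 1) := by
      have h : Continuous fun δ : ℝ => exp (-δ) := by fun_prop
      simpa using (h.tendsto 0).mono_left nhdsWithin_le_nhds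
    exact this.eventually_const_lt (by linarith [hε.1])
  refine le_of_tendsto hcont ?_
  filter_upwards [hsmall, self_mem_nhdsWithin] with δ hδε hδ
  have hlim : Tendsto (fun n : ℕ => exp (h / M.lam - δ) *
      ((M.P n M.θ0).real (M.supportSet n k) - (M.P n M.θ0).real (M.nearSet n h δ)ᶜ -
        (M.P n M.θ0).real (M.nearSet n b δ)ᶜ)) atTop
      (𝓝 (exp (h / M.lam - δ) * exp (-(k / M.lam)))) := by
    simpa using (((M.tendsto_P_supportSet (hh.trans_le hk)).sub
      (M.tendsto_P_compl_nearSet hh hδ)).sub (M.tendsto_P_compl_nearSet hb hδ)).const_mul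
      (exp (h / M.lam - δ))
  rw [← hlim.liminf_eq]
  refine liminf_le_liminf ?_ hlim.isBoundedUnder_ge ?_
  · filter_upwards [M.eventually_integral_phiPlus hα hε, M.eventually_local_mem_N h,
      M.eventually_local_mem_N b, M.eventually_g_le_local hh.le, M.eventually_g_le_local hb.le,
      M.eventually_g_local_le hk, M.eventually_g_local_le hbk] with n hn hNh hNb hgh hgb hhk hbk
    rw [hn]
    set B := M.supportSet n k ∩ M.nearSet n h δ ∩ M.nearSet n b δ with hB_def
    have hB : MeasurableSet B := ((M.measurableSet_supportSet n k).inter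
      (M.measurableSet_nearSet hNh δ)).inter (M.measurableSet_nearSet hNb δ)
    have hBR : B ⊆ M.rejectionSet n b ε α := by
      refine Set.Subset.trans ?_ (M.inter_subset_rejectionSet (δ := δ) hNb hgb ?_ hα.1)
      · exact fun y hy => ⟨fun i => hbk.trans (hy.1.1 i), hy.2⟩
      · rw [sub_eq_add_neg (b / M.lam), exp_add, ← mul_assoc, hαb, one_mul]
        exact hδε.le
    have h1 := M.exp_mul_P_le (δ := δ) hNh hgh hB (fun y hy i => hhk.trans (hy.1.1 i))
      (fun y hy => hy.1.2)
    have h2 : (M.P n M.θ0).real (M.supportSet n k) ≤ (M.P n M.θ0).real B +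
        (M.P n M.θ0).real (M.nearSet n h δ)ᶜ + (M.P n M.θ0).real (M.nearSet n b δ)ᶜ := by
      have hsub : M.supportSet n k ⊆ (B ∪ (M.nearSet n h δ)ᶜ) ∪ (M.nearSet n b δ)ᶜ := by
        intro y hy
        by_cases h1 : y ∈ M.nearSet n h δ
        · by_cases h2 : y ∈ M.nearSet n b δ
          · exact Or.inl (Or.inl ⟨⟨hy, h1⟩, h2⟩)
          · exact Or.inr h2
        · exact Or.inl (Or.inr h1)
      refine (measureReal_mono hsub).trans ((measureReal_union_le _ _).trans ?_)
      gcongr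
      exact measureReal_union_le _ _
    refine le_trans ?_ (h1.trans (measureReal_mono hBR))
    exact mul_le_mul_of_nonneg_left (by linarith) (exp_pos _).le
  · exact (isBoundedUnder_of ⟨1, fun n => (M.integral_P_mem_Icc
      (M.phiPlus_mem_Icc hα.1 hε.1 n)).2⟩).isCoboundedUnder_ge

/-- Asymptotic upper bound for the power of a test of level `α` against `θ0 + h / n`. -/
lemma limsup_integral_P_local_le {α h : ℝ} (hh : 0 < h) {ψ : (n : ℕ) → (Fin n → ℝ) → ℝ}
    (hψ : ∀ n, Measurable (ψ n)) (hψ01 : ∀ n y, ψ n y ∈ Set.Icc (0 : ℝ) 1)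
    (hα : limsup (fun n : ℕ => ∫ y, ψ n y ∂M.P n M.θ0) atTop ≤ α) :
    limsup (fun n : ℕ => ∫ y, ψ n y ∂M.P n (M.θ0 + h / n)) atTop ≤ α * exp (h / M.lam) := by
  have hcont : Tendsto
      (fun δ : ℝ => exp (h / M.lam + δ) * (α + δ) + (1 - exp (-δ) + δ)) (𝓝[>] 0)
      (𝓝 (α * exp (h / M.lam))) := by
    have : Continuous fun δ : ℝ =>
      exp (h / M.lam + δ) * (α + δ) + (1 - exp (-δ) + δ) := by fun_prop
    convert (this.tendsto 0).mono_left nhdsWithin_le_nhds using 2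
    simp [mul_comm]
  refine ge_of_tendsto hcont ?_
  filter_upwards [self_mem_nhdsWithin] with δ hδ
  have hδ0 : 0 < δ := hδ
  refine limsup_le_of_le (isBoundedUnder_of ⟨0, fun n => (M.integral_P_mem_Icc
    (hψ01 n)).1⟩).isCoboundedUnder_le ?_
  filter_upwards [M.eventually_P_local_compl_nearSet_lt hh hδ (lt_add_of_pos_right _ hδ0),
    M.eventually_local_mem_N h, M.eventually_g_le_local hh.le,
    eventually_lt_of_limsup_lt (hα.trans_lt (lt_add_of_pos_right α hδ0))
      (isBoundedUnder_of ⟨1, fun n => (M.integral_P_mem_Icc (hψ01 n)).2⟩)] with n hn hN hg hlt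
  refine (M.integral_P_local_le (δ := δ) hN hg (hψ n) (hψ01 n)).trans (add_le_add ?_ hn.le)
  exact mul_le_mul_of_nonneg_left hlt.le (exp_pos _).le

end BenchmarkModel

namespace BenchmarkModel

/-- Theorem 1: with `h̄⁺ = −λ log α`, the one-sided NLR test is asymptotically
uniformly most powerful at level `α` against positive alternatives. -/
theorem nlr_plus_AUMP (M : BenchmarkModel) (α ε : ℝ) (hα : α ∈ Set.Ioo (0 : ℝ) 1)
    (hε : ε ∈ Set.Ioo (0 : ℝ) 1) :
    Filter.limsup
        (fun n : ℕ => ∫ y, M.phiPlus n (-M.lam * Real.log α) ε α y ∂ M.P n M.θ0) atTop ≤ α ∧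
    ∀ ψ : (n : ℕ) → (Fin n → ℝ) → ℝ,
      (∀ n, Measurable (ψ n)) → (∀ n y, ψ n y ∈ Set.Icc (0 : ℝ) 1) →
      Filter.limsup (fun n : ℕ => ∫ y, ψ n y ∂ M.P n M.θ0) atTop ≤ α →
      ∀ h : ℝ, 0 < h →
        Filter.limsup (fun n : ℕ => ∫ y, ψ n y ∂ M.P n (M.θ0 + h / n)) atTop ≤
          Filter.liminf
            (fun n : ℕ => ∫ y, M.phiPlus n (-M.lam * Real.log α) ε α y ∂ M.P n (M.θ0 + h / n))
            atTop := by
  refine ⟨M.limsup_integral_phiPlus_le hα hε, fun ψ hψ hψ01 hlevel h hh => ?_⟩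
  rcases le_total (-M.lam * log α) h with hb | hb
  · refine le_trans ?_ (M.le_liminf_integral_phiPlus hα hε hh le_rfl hb)
    rw [sub_self, exp_zero]
    exact limsup_le_of_le (isBoundedUnder_of ⟨0, fun n => (M.integral_P_mem_Icc
      (hψ01 n)).1⟩).isCoboundedUnder_le (.of_forall fun n => (M.integral_P_mem_Icc (hψ01 n)).2)
  · refine le_trans (M.limsup_integral_P_local_le hh hψ hψ01 hlevel) ?_
    refine le_trans (le_of_eq ?_) (M.le_liminf_integral_phiPlus hα hε hh hb le_rfl)
    have hlam := M.lam_pos.ne'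
    rw [show -M.lam * log α / M.lam = -log α by field_simp, sub_neg_eq_add, exp_add,
      exp_log hα.1, mul_comm]

end BenchmarkModel
end
end

section
/- For every h̄ < 0, α ∈ (0,1) and ε ∈ (0,1), the negative-side NLR test satisfies limsup_{n→∞} ∫ φ_n(y|h̄,ε) dP^n_{θ0}(y) ≤ α. -/
open MeasureTheory Filter Real Topology

noncomputable section

attribute [local instance] Classical.propDecidable

namespace BenchmarkModel

variable (M : BenchmarkModel)

/-- The negative-side NLR test `φ_n(·|h̄,ε)` at significance level `α`
(rejection clause taking priority). -/
def phiMinus (n : ℕ) (hb ε α : ℝ) : (Fin n → ℝ) → ℝ := fun y =>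
  if exp (hb / M.lam) * (1 + ε) < M.Z n 0 hb y ∨ ∃ i, y i < M.g M.θ0 then 1
  else if M.Z n 0 hb y ∈ Set.Icc (exp (hb / M.lam) * (1 - ε)) (exp (hb / M.lam) * (1 + ε)) then α
  else 0

end BenchmarkModel

namespace BenchmarkModel

variable (M : BenchmarkModel)

/-- Differentiability at `x` along the sequence `x + h / n`. -/
theorem tendsto_nat_mul_sub_of_hasDerivAt {φ : ℝ → ℝ} {d x : ℝ} (hφ : HasDerivAt φ d x) (h : ℝ) :
    Tendsto (fun n : ℕ => (n : ℝ) * (φ (x + h / n) - φ x)) atTop (𝓝 (h * d)) := by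
  have h1 : HasDerivAt (fun t : ℝ => φ (x + h * t)) (d * h) 0 := by
    have h2 : HasDerivAt (fun t : ℝ => x + h * t) h 0 := by
      simpa using ((hasDerivAt_id (0 : ℝ)).const_mul h).const_add x
    have h3 : HasDerivAt φ d (x + h * 0) := by simpa using hφ
    exact h3.comp (0 : ℝ) h2
  have h4 := h1.tendsto_slope_zero_right.comp
    (tendsto_inv_atTop_nhdsGT_zero.comp (tendsto_natCast_atTop_atTop (R := ℝ)))
  rw [mul_comm h d]
  refine h4.congr fun n => ?_
  simp [div_eq_mul_inv]

theorem tendsto_add_div_nat (x h : ℝ) :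
    Tendsto (fun n : ℕ => x + h / n) atTop (𝓝 x) := by
  simpa using (tendsto_const_nhds (x := x)).add (tendsto_const_div_atTop_nhds_zero_nat h)

/-- The integrable envelope of the squared score. -/
def scoreEnvelope (y : ℝ) : ENNReal :=
  ⨆ θ ∈ M.N, ⨆ θ' ∈ M.N, ENNReal.ofReal
    ((deriv (fun t => M.f y t) θ') ^ 2 / (M.f y θ') ^ 2 *
      (if M.g θ ≤ y then 1 else 0) * M.f y θ)

theorem le_scoreEnvelope {y θ θ' : ℝ} (hθ : θ ∈ M.N) (hθ' : θ' ∈ M.N) (hy : M.g θ ≤ y) :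
    ENNReal.ofReal ((deriv (fun t => M.f y t) θ') ^ 2 / (M.f y θ') ^ 2 * M.f y θ) ≤
      M.scoreEnvelope y := by
  refine le_trans ?_ (le_iSup₂_of_le θ hθ (le_iSup₂_of_le θ' hθ' le_rfl))
  rw [if_pos hy, mul_one]

theorem lintegral_scoreEnvelope_ne_top : ∫⁻ y, M.scoreEnvelope y ≠ ⊤ := M.int2.ne

/-- A left neighbourhood of `θ0` inside `N` on which `g` lies below `g θ0`. -/
theorem exists_left_neighborhood :
    ∃ δ > 0, ∀ θ ∈ Set.Ioo (M.θ0 - δ) M.θ0, Set.Icc θ M.θ0 ⊆ M.N ∧ M.g θ < M.g M.θ0 := by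
  have hg : HasDerivAt M.g (deriv M.g M.θ0) M.θ0 :=
    (M.g_smooth.differentiable one_ne_zero).differentiableAt.hasDerivAt
  have h1 : ∀ᶠ θ in 𝓝[<] M.θ0, M.g θ < M.g M.θ0 := by
    have h2 := (hasDerivAt_iff_tendsto_slope.1 hg).mono_left
      (nhdsWithin_mono M.θ0 (fun x (hx : x < M.θ0) => hx.ne) : 𝓝[<] M.θ0 ≤ 𝓝[≠] M.θ0)
    filter_upwards [h2.eventually (lt_mem_nhds M.g_deriv_pos), self_mem_nhdsWithin] with θ h3 h4
    rw [slope_def_field] at h3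
    have h5 : θ - M.θ0 < 0 := sub_neg.2 h4
    by_contra! h6
    exact h3.not_ge (div_nonpos_of_nonneg_of_nonpos (sub_nonneg.2 h6) h5.le)
  obtain ⟨l, hl, hl'⟩ := mem_nhdsLT_iff_exists_Ioo_subset.1 h1
  obtain ⟨δ, hδ, hδ'⟩ := Metric.isOpen_iff.1 M.N_open _ M.θ0_mem
  have hl2 : l < M.θ0 := hl
  refine ⟨min δ (M.θ0 - l), lt_min hδ (sub_pos.2 hl2), fun θ hθ => ⟨fun c hc => hδ' ?_, hl' ⟨?_, hθ.2⟩⟩⟩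
  · rw [Metric.mem_ball, Real.dist_eq, abs_lt]
    have := min_le_left δ (M.θ0 - l)
    constructor <;> linarith [hc.1, hc.2, hθ.1, hθ.2]
  · have := min_le_right δ (M.θ0 - l)
    linarith [hθ.1]

theorem eventually_add_div_mem_Ioo {x h δ : ℝ} (hh : h < 0) (hδ : 0 < δ) :
    ∀ᶠ n : ℕ in atTop, x + h / n ∈ Set.Ioo (x - δ) x := by
  filter_upwards [(tendsto_add_div_nat x h).eventually (lt_mem_nhds (sub_lt_self x hδ)),
    eventually_gt_atTop 0] with n h1 h2
  exact ⟨h1, add_lt_of_neg_right x (div_neg_of_neg_of_pos hh (Nat.cast_pos.2 h2))⟩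

theorem exists_sub_eq_deriv_mul (y : ℝ) {θ : ℝ} (hθ : θ < M.θ0) :
    ∃ c ∈ Set.Ioo θ M.θ0,
      M.f y M.θ0 - M.f y θ = deriv (fun t => M.f y t) c * (M.θ0 - θ) := by
  have hd : Differentiable ℝ (fun t => M.f y t) := (M.f_smooth y).differentiable two_ne_zero
  obtain ⟨c, hc, h⟩ := exists_deriv_eq_slope (fun t => M.f y t) hθ hd.continuous.continuousOn
    hd.differentiableOn
  refine ⟨c, hc, ?_⟩
  rw [h, div_mul_cancel₀ _ (sub_pos.2 hθ).ne']

theorem exists_sqrt_sub_eq_deriv_mul (y : ℝ) {θ : ℝ} (hθ : θ < M.θ0)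
    (hN : Set.Icc θ M.θ0 ⊆ M.N) :
    ∃ c ∈ Set.Ioo θ M.θ0,
      √(M.f y M.θ0) - √(M.f y θ) =
        deriv (fun t => M.f y t) c / (2 * √(M.f y c)) * (M.θ0 - θ) := by
  have hd : Differentiable ℝ (fun t => M.f y t) := (M.f_smooth y).differentiable two_ne_zero
  obtain ⟨c, hc, h⟩ := exists_hasDerivAt_eq_slope (fun t => √(M.f y t))
    (fun c => deriv (fun t => M.f y t) c / (2 * √(M.f y c))) hθ
    hd.continuous.sqrt.continuousOn
    (fun c hc => (hd c).hasDerivAt.sqrt (M.f_pos c (hN (Set.Ioo_subset_Icc_self hc)) y).ne')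
  refine ⟨c, hc, ?_⟩
  rw [h, div_mul_cancel₀ _ (sub_pos.2 hθ).ne']

theorem sq_sqrt_sub_le_scoreEnvelope {y θ : ℝ} (hθ : θ < M.θ0) (hN : Set.Icc θ M.θ0 ⊆ M.N)
    (hg : ∀ c ∈ Set.Ioo θ M.θ0, M.g c ≤ y) :
    ENNReal.ofReal ((√(M.f y θ) - √(M.f y M.θ0)) ^ 2) ≤
      ENNReal.ofReal ((M.θ0 - θ) ^ 2) * M.scoreEnvelope y := by
  obtain ⟨c, hc, h⟩ := M.exists_sqrt_sub_eq_deriv_mul y hθ hN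
  have hcN := hN (Set.Ioo_subset_Icc_self hc)
  have hpos := M.f_pos c hcN y
  refine le_trans ?_ (mul_le_mul_right (M.le_scoreEnvelope hcN hcN (hg c hc)) _)
  rw [← ENNReal.ofReal_mul (sq_nonneg _)]
  refine ENNReal.ofReal_le_ofReal ?_
  rw [← neg_sub, neg_sq, h, mul_pow, div_pow, mul_pow, Real.sq_sqrt hpos.le, mul_comm]
  refine mul_le_mul_of_nonneg_left ?_ (sq_nonneg _)
  rw [show deriv (fun t => M.f y t) c ^ 2 / M.f y c ^ 2 * M.f y c =
    deriv (fun t => M.f y t) c ^ 2 / M.f y c by field_simp]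
  exact div_le_div_of_nonneg_left (sq_nonneg _) hpos (by linarith)

/-- The squared Hellinger-type distance above the boundary `g θ0` is `o(1/n)`. -/
theorem tendsto_nat_mul_hellinger {hb : ℝ} (hhb : hb < 0) :
    Tendsto (fun n : ℕ => (n : ℝ) * ∫ y in Set.Ici (M.g M.θ0),
      (√(M.f y (M.θ0 + hb / n)) - √(M.f y M.θ0)) ^ 2) atTop (𝓝 0) := by
  obtain ⟨δ, hδ, H⟩ := M.exists_left_neighborhood
  have hlim := tendsto_const_div_atTop_nhds_zero_nat
    (hb ^ 2 * (∫⁻ y, M.scoreEnvelope y).toReal)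
  refine squeeze_zero' (Eventually.of_forall fun n => mul_nonneg n.cast_nonneg
    (integral_nonneg fun y => sq_nonneg _)) ?_ hlim
  filter_upwards [eventually_add_div_mem_Ioo (x := M.θ0) hhb hδ, eventually_gt_atTop 0]
    with n hn hn0
  have hn0' : (0 : ℝ) < n := Nat.cast_pos.2 hn0
  obtain ⟨hN, -⟩ := H _ hn
  have hc1 := M.f_cont _ (hN ⟨le_rfl, hn.2.le⟩)
  have hc0 := M.f_cont _ M.θ0_mem
  have hbound : ∫ y in Set.Ici (M.g M.θ0),
      (√(M.f y (M.θ0 + hb / n)) - √(M.f y M.θ0)) ^ 2 ≤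
      (hb / n) ^ 2 * (∫⁻ y, M.scoreEnvelope y).toReal := by
    rw [integral_eq_lintegral_of_nonneg_ae (Eventually.of_forall fun y => sq_nonneg _)
      (show Continuous fun y => (√(M.f y (M.θ0 + hb / n)) - √(M.f y M.θ0)) ^ 2 by
        fun_prop).aestronglyMeasurable]
    rw [← ENNReal.toReal_ofReal (sq_nonneg (hb / n)), ← ENNReal.toReal_mul]
    refine ENNReal.toReal_mono
      (ENNReal.mul_ne_top ENNReal.ofReal_ne_top M.lintegral_scoreEnvelope_ne_top) ?_
    rw [← lintegral_const_mul' _ _ ENNReal.ofReal_ne_top]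
    refine le_trans (setLIntegral_mono' measurableSet_Ici fun y hy => ?_)
      (setLIntegral_le_lintegral (Set.Ici (M.g M.θ0)) _)
    refine (M.sq_sqrt_sub_le_scoreEnvelope hn.2 hN fun c hc => ?_).trans_eq ?_
    · exact (H c ⟨hn.1.trans hc.1, hc.2⟩).2.le.trans hy
    · congr 2; ring
  calc _ ≤ (n : ℝ) * ((hb / n) ^ 2 * (∫⁻ y, M.scoreEnvelope y).toReal) :=
        mul_le_mul_of_nonneg_left hbound hn0'.le
    _ = _ := by field_simp

theorem tendsto_nat_mul_boundary_integral {hb : ℝ} (hhb : hb < 0) :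
    Tendsto (fun n : ℕ => (n : ℝ) * ∫ y in Set.Ico (M.g (M.θ0 + hb / n)) (M.g M.θ0), M.f y M.θ0)
      atTop (𝓝 (-(hb / M.lam))) := by
  obtain ⟨δ, hδ, H⟩ := M.exists_left_neighborhood
  have hg : HasDerivAt M.g (deriv M.g M.θ0) M.θ0 :=
    (M.g_smooth.differentiable one_ne_zero).differentiableAt.hasDerivAt
  have hΨ := ((M.f_cont _ M.θ0_mem).integral_hasStrictDerivAt
    (M.g M.θ0) (M.g M.θ0)).hasDerivAt.comp M.θ0 hg
  have hlim := (tendsto_nat_mul_sub_of_hasDerivAt hΨ hb).neg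
  rw [lam, div_inv_eq_mul]
  refine hlim.congr' ?_
  filter_upwards [eventually_add_div_mem_Ioo (x := M.θ0) hhb hδ] with n hn
  have hle := (H _ hn).2.le
  rw [integral_Ico_eq_integral_Ioc, ← intervalIntegral.integral_of_le hle]
  simp only [Function.comp_apply, intervalIntegral.integral_same, sub_zero]
  rw [intervalIntegral.integral_symm, mul_neg, neg_neg]

theorem abs_sub_le_of_mem_Ioo (y : ℝ) {θ : ℝ} (hθ : θ < M.θ0) (hN : Set.Icc θ M.θ0 ⊆ M.N) :
    ∃ c ∈ Set.Ioo θ M.θ0, |M.f y θ - M.f y M.θ0| ≤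
      M.C * (M.θ0 - θ) * (1 + deriv (fun t => M.f y t) c ^ 2 / M.f y c ^ 2) := by
  obtain ⟨c, hc, h⟩ := M.exists_sub_eq_deriv_mul y hθ
  have hcN := hN (Set.Ioo_subset_Icc_self hc)
  have hpos := M.f_pos c hcN y
  have hlt := M.f_lt c hcN y
  refine ⟨c, hc, ?_⟩
  set s := deriv (fun t => M.f y t) c / M.f y c with hs
  have hsd : deriv (fun t => M.f y t) c = s * M.f y c := by rw [hs]; field_simp
  rw [← div_pow, ← hs]
  have h1 : |s| ≤ 1 + s ^ 2 := by
    rw [abs_le]; constructor <;> nlinarith [sq_nonneg (s - 1), sq_nonneg (s + 1)]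
  have hθ' := sub_pos.2 hθ
  rw [abs_sub_comm, h, hsd, abs_mul, abs_mul, abs_of_pos hpos, abs_of_pos hθ']
  calc |s| * M.f y c * (M.θ0 - θ) ≤ (1 + s ^ 2) * M.C * (M.θ0 - θ) := by gcongr
    _ = _ := by ring

theorem tendsto_nat_mul_boundary_error {hb : ℝ} (hhb : hb < 0) :
    Tendsto (fun n : ℕ => (n : ℝ) * ∫ y in Set.Ico (M.g (M.θ0 + hb / n)) (M.g M.θ0),
      (M.f y (M.θ0 + hb / n) - M.f y M.θ0)) atTop (𝓝 0) := by
  obtain ⟨δ, hδ, H⟩ := M.exists_left_neighborhood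
  have hθm : M.θ0 - δ / 2 ∈ Set.Ioo (M.θ0 - δ) M.θ0 := by constructor <;> linarith
  set θm := M.θ0 - δ / 2
  obtain ⟨hNm, hgm⟩ := H θm hθm
  have hmN : θm ∈ M.N := hNm ⟨le_rfl, hθm.2.le⟩
  set I := Set.Icc (M.g θm) (M.g M.θ0)
  obtain ⟨y₀, -, hmin⟩ := isCompact_Icc.exists_isMinOn (Set.nonempty_Icc.2 hgm.le)
    (M.f_cont θm hmN).continuousOn
  have hm := M.f_pos θm hmN y₀
  set m := M.f y₀ θm
  have hC : 0 < M.C := (M.f_pos _ M.θ0_mem 0).trans (M.f_lt _ M.θ0_mem 0)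
  set G : ℝ → ENNReal := fun y => ENNReal.ofReal (M.C * -hb) *
    (I.indicator 1 y + ENNReal.ofReal m⁻¹ * M.scoreEnvelope y) with hG
  have hGint : ∫⁻ y, G y ≠ ⊤ := by
    rw [hG, lintegral_const_mul' _ _ ENNReal.ofReal_ne_top,
      lintegral_add_left (measurable_one.indicator measurableSet_Icc),
      lintegral_const_mul' _ _ ENNReal.ofReal_ne_top, lintegral_indicator_one measurableSet_Icc,
      Real.volume_Icc]
    exact ENNReal.mul_ne_top ENNReal.ofReal_ne_top (ENNReal.add_ne_top.2
      ⟨ENNReal.ofReal_ne_top, ENNReal.mul_ne_top ENNReal.ofReal_ne_top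
        M.lintegral_scoreEnvelope_ne_top⟩)
  have hgn : Tendsto (fun n : ℕ => M.g (M.θ0 + hb / n)) atTop (𝓝 (M.g M.θ0)) :=
    (M.g_smooth.continuous.tendsto _).comp (tendsto_add_div_nat M.θ0 hb)
  have hvol : Tendsto ((volume : Measure ℝ) ∘
      fun n : ℕ => Set.Ico (M.g (M.θ0 + hb / n)) (M.g M.θ0)) atTop (𝓝 0) := by
    have h1 : Tendsto (fun n : ℕ => M.g M.θ0 - M.g (M.θ0 + hb / n)) atTop (𝓝 0) := by
      simpa using hgn.const_sub (M.g M.θ0)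
    have h2 := ENNReal.tendsto_ofReal h1
    rw [ENNReal.ofReal_zero] at h2
    exact h2.congr fun n => by rw [Function.comp_apply, Real.volume_Ico]
  have hlim := (ENNReal.tendsto_toReal ENNReal.zero_ne_top).comp
    (tendsto_setLIntegral_zero hGint hvol)
  rw [ENNReal.toReal_zero] at hlim
  refine squeeze_zero_norm' ?_ hlim
  filter_upwards [eventually_add_div_mem_Ioo (x := M.θ0) hhb hδ,
    eventually_add_div_mem_Ioo (x := M.θ0) hhb (half_pos hδ), eventually_gt_atTop 0,
    hgn.eventually (lt_mem_nhds hgm)] with n hn hn2 hn0 hgmn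
  have hn0' : (0 : ℝ) < n := Nat.cast_pos.2 hn0
  obtain ⟨hN, -⟩ := H _ hn
  rw [← integral_const_mul, Function.comp_apply]
  refine ENNReal.ofReal_le_ofReal_iff ENNReal.toReal_nonneg |>.1 ?_
  have hfin : ∫⁻ y in Set.Ico (M.g (M.θ0 + hb / n)) (M.g M.θ0), G y ≠ ⊤ :=
    ((setLIntegral_le_lintegral _ _).trans_lt hGint.lt_top).ne
  rw [ofReal_norm, ENNReal.ofReal_toReal hfin]
  refine (enorm_integral_le_lintegral_enorm _).trans
    (setLIntegral_mono' measurableSet_Ico fun y hy => ?_)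
  have hyI : y ∈ I := ⟨hgmn.le.trans hy.1, hy.2.le⟩
  obtain ⟨c, hc, habs⟩ := M.abs_sub_le_of_mem_Ioo y hn.2 hN
  have hcN := hN (Set.Ioo_subset_Icc_self hc)
  set q := deriv (fun t => M.f y t) c ^ 2 / M.f y c ^ 2 with hq
  have hq0 : 0 ≤ q := by positivity
  have hmy : m ≤ M.f y θm := hmin hyI
  have henv : ENNReal.ofReal q ≤ ENNReal.ofReal m⁻¹ * M.scoreEnvelope y := by
    refine le_trans ?_ (mul_le_mul_right (M.le_scoreEnvelope hmN hcN hyI.1) _)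
    rw [← ENNReal.ofReal_mul (inv_nonneg.2 hm.le), ← hq]
    refine ENNReal.ofReal_le_ofReal ?_
    rw [inv_mul_eq_div, le_div_iff₀ hm]
    exact mul_le_mul_of_nonneg_left hmy hq0
  calc ‖(n : ℝ) * (M.f y (M.θ0 + hb / n) - M.f y M.θ0)‖ₑ
      = ENNReal.ofReal (n * |M.f y (M.θ0 + hb / n) - M.f y M.θ0|) := by
        rw [← ofReal_norm, norm_mul, Real.norm_eq_abs, Real.norm_eq_abs, abs_of_pos hn0']
    _ ≤ ENNReal.ofReal (M.C * -hb * (1 + q)) := by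
        refine ENNReal.ofReal_le_ofReal
          ((mul_le_mul_of_nonneg_left habs hn0'.le).trans_eq ?_)
        field_simp
        ring
    _ = ENNReal.ofReal (M.C * -hb) * (1 + ENNReal.ofReal q) := by
        rw [ENNReal.ofReal_mul (mul_nonneg hC.le (neg_nonneg.2 hhb.le)),
          ENNReal.ofReal_add zero_le_one hq0, ENNReal.ofReal_one]
    _ ≤ G y := by
        rw [hG]
        simp only [Set.indicator_of_mem hyI, Pi.one_apply]
        gcongr

/-- The mass of `f(·|θ0 + hb/n)` below `g θ0` is asymptotically `-hb / (λ n)`. -/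
theorem tendsto_nat_mul_lost_mass {hb : ℝ} (hhb : hb < 0) :
    Tendsto (fun n : ℕ => (n : ℝ) *
      ((∫ y in Set.Ici (M.g M.θ0), M.f y (M.θ0 + hb / n)) - 1)) atTop (𝓝 (hb / M.lam)) := by
  obtain ⟨δ, hδ, H⟩ := M.exists_left_neighborhood
  have hlim :=
    ((M.tendsto_nat_mul_boundary_integral hhb).add (M.tendsto_nat_mul_boundary_error hhb)).neg
  rw [add_zero, neg_neg] at hlim
  refine hlim.congr' ?_
  filter_upwards [eventually_add_div_mem_Ioo (x := M.θ0) hhb hδ] with n hn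
  obtain ⟨hN, hle⟩ := H _ hn
  have hc1 := M.f_cont _ (hN ⟨le_rfl, hn.2.le⟩)
  have hc0 := M.f_cont _ M.θ0_mem
  have hi1 : IntegrableOn (fun y => M.f y (M.θ0 + hb / n))
      (Set.Ico (M.g (M.θ0 + hb / n)) (M.g M.θ0)) :=
    hc1.integrableOn_Icc.mono_set Set.Ico_subset_Icc_self
  have hi0 : IntegrableOn (fun y => M.f y M.θ0)
      (Set.Ico (M.g (M.θ0 + hb / n)) (M.g M.θ0)) :=
    hc0.integrableOn_Icc.mono_set Set.Ico_subset_Icc_self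
  have hdens := M.f_density (M.θ0 + hb / n)
  rw [← Set.Ico_union_Ici_eq_Ici hle.le, setIntegral_union
    ((Set.Iio_disjoint_Ici le_rfl).mono_left Set.Ico_subset_Iio_self) measurableSet_Ici hi1
    ((M.f_integrable _).mono_set (Set.Ici_subset_Ici.2 hle.le))] at hdens
  rw [integral_sub hi1 hi0, ← hdens]
  ring

theorem integrableOn_sqrt_mul {θ : ℝ} (hθ : θ ∈ M.N) (hg : M.g θ ≤ M.g M.θ0) :
    IntegrableOn (fun y => √(M.f y θ * M.f y M.θ0)) (Set.Ici (M.g M.θ0)) := by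
  have hc1 := M.f_cont _ hθ
  have hc0 := M.f_cont _ M.θ0_mem
  refine Integrable.mono' (((M.f_integrable θ).mono_set (Set.Ici_subset_Ici.2 hg)).add
    (M.f_integrable M.θ0)) (hc1.mul hc0).sqrt.aestronglyMeasurable
    (Eventually.of_forall fun y => ?_)
  have h1 := M.f_pos θ hθ y
  have h0 := M.f_pos _ M.θ0_mem y
  rw [Real.norm_eq_abs, abs_of_nonneg (Real.sqrt_nonneg _), Pi.add_apply]
  refine Real.sqrt_le_iff.2 ⟨by positivity, ?_⟩
  nlinarith [mul_pos h1 h0]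

theorem tendsto_nat_mul_affinity {hb : ℝ} (hhb : hb < 0) :
    Tendsto (fun n : ℕ => (n : ℝ) *
      ((∫ y in Set.Ici (M.g M.θ0), √(M.f y (M.θ0 + hb / n) * M.f y M.θ0)) - 1)) atTop
      (𝓝 (hb / M.lam / 2)) := by
  obtain ⟨δ, hδ, H⟩ := M.exists_left_neighborhood
  have hlim := ((M.tendsto_nat_mul_lost_mass hhb).sub (M.tendsto_nat_mul_hellinger hhb)).div_const 2
  rw [sub_zero] at hlim
  refine hlim.congr' ?_
  filter_upwards [eventually_add_div_mem_Ioo (x := M.θ0) hhb hδ] with n hn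
  obtain ⟨hN, hle⟩ := H _ hn
  have hθN := hN ⟨le_rfl, hn.2.le⟩
  have hi1 : IntegrableOn (fun y => M.f y (M.θ0 + hb / n)) (Set.Ici (M.g M.θ0)) :=
    (M.f_integrable _).mono_set (Set.Ici_subset_Ici.2 hle.le)
  have hiR := M.integrableOn_sqrt_mul hθN hle.le
  have key : ∫ y in Set.Ici (M.g M.θ0), (√(M.f y (M.θ0 + hb / n)) - √(M.f y M.θ0)) ^ 2 =
      (∫ y in Set.Ici (M.g M.θ0), M.f y (M.θ0 + hb / n)) + 1 -
        2 * ∫ y in Set.Ici (M.g M.θ0), √(M.f y (M.θ0 + hb / n) * M.f y M.θ0) := by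
    rw [← M.f_density M.θ0, ← integral_const_mul, ← integral_add hi1 (M.f_integrable _),
      ← integral_sub (hi1.fun_add (M.f_integrable _)) (hiR.const_mul 2)]
    refine integral_congr_ae (Eventually.of_forall fun y => ?_)
    have h1 := M.f_pos _ hθN y
    have h0 := M.f_pos _ M.θ0_mem y
    simp only
    rw [sub_sq, Real.sq_sqrt h1.le, Real.sq_sqrt h0.le, Real.sqrt_mul h1.le]
    ring
  rw [key]
  ring

theorem integrable_prod_indicator {S : Set ℝ} (hS : MeasurableSet S) {u : ℝ → ℝ}
    (hu : IntegrableOn u S) (n : ℕ) :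
    Integrable fun y : Fin n → ℝ => ∏ i, S.indicator u (y i) :=
  Integrable.fintype_prod (f := fun _ => S.indicator u) fun _ => hu.integrable_indicator hS

theorem integral_prod_indicator {S : Set ℝ} (hS : MeasurableSet S) (u : ℝ → ℝ) (n : ℕ) :
    ∫ y : Fin n → ℝ, ∏ i, S.indicator u (y i) = (∫ x in S, u x) ^ n := by
  rw [integral_fintype_prod_volume_eq_pow, integral_indicator hS, Fintype.card_fin]

theorem integral_P_eq (n : ℕ) (φ : (Fin n → ℝ) → ℝ) :
    ∫ y, φ y ∂ M.P n M.θ0 =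
      ∫ y, (∏ i, (Set.Ici (M.g M.θ0)).indicator (fun x => M.f x M.θ0) (y i)) * φ y := by
  have hind : ∀ x, (M.f x M.θ0 * if M.g M.θ0 ≤ x then 1 else 0) =
      (Set.Ici (M.g M.θ0)).indicator (fun x => M.f x M.θ0) x := fun x => by
    simp [Set.indicator_apply]
  have hmeas : Measurable ((Set.Ici (M.g M.θ0)).indicator fun x => M.f x M.θ0) :=
    (M.f_cont _ M.θ0_mem).measurable.indicator measurableSet_Ici
  simp only [P, hind]
  rw [integral_withDensity_eq_integral_toReal_smul (by fun_prop)
    (Eventually.of_forall fun y => ENNReal.ofReal_lt_top)]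
  refine integral_congr_ae (Eventually.of_forall fun y => ?_)
  simp only [smul_eq_mul]
  rw [ENNReal.toReal_ofReal]
  exact Finset.prod_nonneg fun i _ =>
    Set.indicator_nonneg (fun x _ => (M.f_pos _ M.θ0_mem x).le) _

theorem phiMinus_nonneg {α : ℝ} (hα : 0 ≤ α) (n : ℕ) (hb ε : ℝ) (y : Fin n → ℝ) :
    0 ≤ M.phiMinus n hb ε α y := by
  unfold phiMinus
  split_ifs
  exacts [zero_le_one, hα, le_rfl]

/-- A Chebyshev-type bound: where `A > a² t² B`, the weight `B` is dominated by the squared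
deviation of `√A` from `a √B`. -/
theorem le_sq_sqrt_sub_of_lt {A B a t : ℝ} (hB : 0 ≤ B) (ha : 0 < a) (ht : 1 < t)
    (h : a ^ 2 * t ^ 2 * B < A) :
    B ≤ ((a * (t - 1)) ^ 2)⁻¹ * (A - 2 * a * √(A * B) + a ^ 2 * B) := by
  have hA : 0 ≤ A := le_trans (by positivity) h.le
  have h1 : a * t * √B ≤ √A := by
    refine Real.le_sqrt_of_sq_le ?_
    rw [mul_pow, mul_pow, Real.sq_sqrt hB]
    exact h.le
  have ht' : 0 < t - 1 := sub_pos.2 ht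
  have h2 : (a * (t - 1) * √B) ^ 2 ≤ (√A - a * √B) ^ 2 :=
    pow_le_pow_left₀ (by positivity) (by linarith) 2
  rw [mul_pow, Real.sq_sqrt hB, sub_sq, mul_pow, Real.sq_sqrt hA, mul_pow a, Real.sq_sqrt hB,
    ← mul_pow] at h2
  rw [inv_mul_eq_div, le_div_iff₀ (by positivity), Real.sqrt_mul hA]
  linarith

theorem density_mul_phiMinus_le {hb α ε : ℝ} (hα : α ∈ Set.Ioo (0 : ℝ) 1)
    (hε : 0 < ε) {n : ℕ} (hN : M.θ0 + hb / n ∈ M.N)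
    (hg : M.g (M.θ0 + hb / n) ≤ M.g M.θ0) (y : Fin n → ℝ) :
    (∏ i, (Set.Ici (M.g M.θ0)).indicator (fun x => M.f x M.θ0) (y i)) * M.phiMinus n hb ε α y ≤
      α * ∏ i, (Set.Ici (M.g M.θ0)).indicator (fun x => M.f x M.θ0) (y i) +
      ((exp (hb / M.lam / 2) * (√(1 + ε) - 1)) ^ 2)⁻¹ *
        (∏ i, (Set.Ici (M.g M.θ0)).indicator (fun x => M.f x (M.θ0 + hb / n)) (y i) -
          2 * exp (hb / M.lam / 2) * ∏ i, (Set.Ici (M.g M.θ0)).indicator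
            (fun x => √(M.f x (M.θ0 + hb / n) * M.f x M.θ0)) (y i) +
          exp (hb / M.lam / 2) ^ 2 *
            ∏ i, (Set.Ici (M.g M.θ0)).indicator (fun x => M.f x M.θ0) (y i)) := by
  by_cases hy : ∀ i, M.g M.θ0 ≤ y i
  · have hind : ∀ u : ℝ → ℝ, ∏ i, (Set.Ici (M.g M.θ0)).indicator u (y i) = ∏ i, u (y i) :=
      fun u => Finset.prod_congr rfl fun i _ => Set.indicator_of_mem (hy i) u
    simp only [hind]
    have hA : 0 < ∏ i, M.f (y i) (M.θ0 + hb / n) := Finset.prod_pos fun i _ => M.f_pos _ hN _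
    have hB : 0 < ∏ i, M.f (y i) M.θ0 := Finset.prod_pos fun i _ => M.f_pos _ M.θ0_mem _
    have hR : ∏ i, √(M.f (y i) (M.θ0 + hb / n) * M.f (y i) M.θ0) =
        √((∏ i, M.f (y i) (M.θ0 + hb / n)) * ∏ i, M.f (y i) M.θ0) := by
      rw [← Finset.prod_mul_distrib, Real.sqrt_prod _ fun i _ =>
        (mul_pos (M.f_pos _ hN _) (M.f_pos _ M.θ0_mem _)).le]
    have hZ : M.Z n 0 hb y = (∏ i, M.f (y i) (M.θ0 + hb / n)) / ∏ i, M.f (y i) M.θ0 := by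
      unfold Z
      rw [zero_div, add_zero, if_pos hy, if_pos fun i => hg.trans (hy i), one_mul,
        Finset.prod_div_distrib]
    have ha : exp (hb / M.lam / 2) ^ 2 = exp (hb / M.lam) := by
      rw [← Real.exp_nat_mul]; congr 1; push_cast; ring
    rw [hR]
    set A := ∏ i, M.f (y i) (M.θ0 + hb / n)
    set B := ∏ i, M.f (y i) M.θ0
    set a := exp (hb / M.lam / 2)
    have ha0 : 0 < a := Real.exp_pos _
    by_cases hrej : exp (hb / M.lam) * (1 + ε) < M.Z n 0 hb y
    · have hphi : M.phiMinus n hb ε α y = 1 := if_pos (Or.inl hrej)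
      rw [hZ, lt_div_iff₀ hB, ← ha, ← Real.sq_sqrt (show 0 ≤ 1 + ε by linarith)] at hrej
      have ht : 1 < √(1 + ε) := Real.lt_sqrt_of_sq_lt (by linarith)
      have := le_sq_sqrt_sub_of_lt hB.le ha0 ht hrej
      have := mul_pos hα.1 hB
      rw [hphi]
      linarith
    · have hphi : M.phiMinus n hb ε α y ≤ α := by
        unfold phiMinus
        rw [if_neg (not_or.2 ⟨hrej, fun ⟨i, hi⟩ => (hy i).not_gt hi⟩)]
        split_ifs
        exacts [le_rfl, hα.1.le]
      have hsq : 0 ≤ A - 2 * a * √(A * B) + a ^ 2 * B := by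
        have h := sq_nonneg (√A - a * √B)
        rw [sub_sq, mul_pow, Real.sq_sqrt hA.le, Real.sq_sqrt hB.le] at h
        rw [Real.sqrt_mul hA.le]
        linarith
      have h1 : B * M.phiMinus n hb ε α y ≤ α * B := by
        rw [mul_comm]; exact mul_le_mul_of_nonneg_right hphi hB.le
      have h2 : 0 ≤ ((a * (√(1 + ε) - 1)) ^ 2)⁻¹ * (A - 2 * a * √(A * B) + a ^ 2 * B) :=
        mul_nonneg (inv_nonneg.2 (sq_nonneg _)) hsq
      linarith
  · obtain ⟨i, hi⟩ := not_forall.1 hy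
    have hind : ∀ u : ℝ → ℝ, ∏ i, (Set.Ici (M.g M.θ0)).indicator u (y i) = 0 :=
      fun u => Finset.prod_eq_zero (Finset.mem_univ i) (Set.indicator_of_notMem hi u)
    simp [hind]

theorem integral_mul_add_mul_sub_add {X : Type*} [MeasurableSpace X] {μ : Measure X}
    {A B R : X → ℝ} (hA : Integrable A μ) (hB : Integrable B μ) (hR : Integrable R μ)
    (α K b c : ℝ) :
    ∫ x, (α * B x + K * (A x - b * R x + c * B x)) ∂μ =
      α * ∫ x, B x ∂μ + K * (∫ x, A x ∂μ - b * ∫ x, R x ∂μ + c * ∫ x, B x ∂μ) := by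
  have h1 : Integrable (fun x => A x - b * R x) μ := hA.sub (hR.const_mul b)
  have h2 : Integrable (fun x => A x - b * R x + c * B x) μ := h1.add (hB.const_mul c)
  rw [integral_add (hB.const_mul α) (h2.const_mul K), integral_const_mul, integral_const_mul,
    integral_add h1 (hB.const_mul c), integral_sub hA (hR.const_mul b), integral_const_mul,
    integral_const_mul]

theorem integral_phiMinus_le {hb α ε : ℝ} (hα : α ∈ Set.Ioo (0 : ℝ) 1)
    (hε : 0 < ε) {n : ℕ} (hN : M.θ0 + hb / n ∈ M.N)
    (hg : M.g (M.θ0 + hb / n) ≤ M.g M.θ0) :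
    ∫ y, M.phiMinus n hb ε α y ∂ M.P n M.θ0 ≤
      α + ((exp (hb / M.lam / 2) * (√(1 + ε) - 1)) ^ 2)⁻¹ *
        ((∫ x in Set.Ici (M.g M.θ0), M.f x (M.θ0 + hb / n)) ^ n -
          2 * exp (hb / M.lam / 2) *
            (∫ x in Set.Ici (M.g M.θ0), √(M.f x (M.θ0 + hb / n) * M.f x M.θ0)) ^ n +
          exp (hb / M.lam / 2) ^ 2) := by
  have hiA := integrable_prod_indicator measurableSet_Ici
    ((M.f_integrable (M.θ0 + hb / n)).mono_set (Set.Ici_subset_Ici.2 hg)) n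
  have hiB := integrable_prod_indicator measurableSet_Ici (M.f_integrable M.θ0) n
  have hiR := integrable_prod_indicator measurableSet_Ici (M.integrableOn_sqrt_mul hN hg) n
  rw [integral_P_eq]
  refine (integral_mono_of_nonneg (Eventually.of_forall fun y => mul_nonneg
    (Finset.prod_nonneg fun i _ => Set.indicator_nonneg (fun x _ => (M.f_pos _ M.θ0_mem x).le) _)
    (M.phiMinus_nonneg hα.1.le n hb ε y)) ?_
    (Eventually.of_forall fun y => M.density_mul_phiMinus_le hα hε hN hg y)).trans_eq ?_
  · exact (hiB.const_mul _).add (((hiA.sub (hiR.const_mul _)).add (hiB.const_mul _)).const_mul _)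
  · rw [integral_mul_add_mul_sub_add hiA hiB hiR, integral_prod_indicator measurableSet_Ici,
      integral_prod_indicator measurableSet_Ici, integral_prod_indicator measurableSet_Ici,
      M.f_density, one_pow, mul_one, mul_one]

end BenchmarkModel

namespace BenchmarkModel

/-- Lemma 2(i): the negative-side NLR test is of asymptotic level `α`. -/
theorem nlr_minus_size (M : BenchmarkModel) (hb α ε : ℝ) (hhb : hb < 0)
    (hα : α ∈ Set.Ioo (0 : ℝ) 1) (hε : ε ∈ Set.Ioo (0 : ℝ) 1) :
    Filter.limsup (fun n : ℕ => ∫ y, M.phiMinus n hb ε α y ∂ M.P n M.θ0) atTop ≤ α := by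
  obtain ⟨δ, hδ, H⟩ := M.exists_left_neighborhood
  have hA := Real.tendsto_one_add_pow_exp_of_tendsto (M.tendsto_nat_mul_lost_mass hhb)
  have hR := Real.tendsto_one_add_pow_exp_of_tendsto (M.tendsto_nat_mul_affinity hhb)
  simp only [add_sub_cancel] at hA hR
  have ha : exp (hb / M.lam) = exp (hb / M.lam / 2) ^ 2 := by
    rw [← Real.exp_nat_mul]; congr 1; push_cast; ring
  have hlim := ((((hA.sub (hR.const_mul (2 * exp (hb / M.lam / 2)))).add_const
    (exp (hb / M.lam / 2) ^ 2))).const_mul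
      ((exp (hb / M.lam / 2) * (√(1 + ε) - 1)) ^ 2)⁻¹).const_add α
  rw [ha, show exp (hb / M.lam / 2) ^ 2 - 2 * exp (hb / M.lam / 2) * exp (hb / M.lam / 2) +
    exp (hb / M.lam / 2) ^ 2 = 0 by ring, mul_zero, add_zero] at hlim
  refine (limsup_le_limsup ?_ ?_ hlim.isBoundedUnder_le).trans_eq hlim.limsup_eq
  · filter_upwards [eventually_add_div_mem_Ioo (x := M.θ0) hhb hδ] with n hn
    obtain ⟨hN, hle⟩ := H _ hn
    exact M.integral_phiMinus_le hα hε.1 (hN ⟨le_rfl, hn.2.le⟩) hle.le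
  · exact (isBoundedUnder_of ⟨0, fun n => integral_nonneg fun y =>
      M.phiMinus_nonneg hα.1.le n hb ε y⟩ : IsBoundedUnder (· ≥ ·) atTop _).isCoboundedUnder_le

end BenchmarkModel
end
end
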